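/- arXiv:1312.3170 — 3 statements merged into one kernel-verified Lean document; each statement's English description precedes it below -/
import Mathlib

section
/- Let f : ℝ^n × ℝ^n → ℝ be continuous with at most polynomial growth, and let S denote the mirror symmetry operator acting by Sf(w_1,w_2) = f(w_2,w_1). Then I_n(f) = I_n(Sf). -/
open MeasureTheory Real

noncomputable def heatG (n : ℕ) (t : ℝ) (x : EuclideanSpace ℝ (Fin n)) : ℝ :=
  (4 * Real.pi * t) ^ (-(n : ℝ) / 2) * Real.exp (-‖x‖ ^ 2 / (4 * t))

/-- `Iₙ(f) = ∫_0^1 ∫_0^{s₁} ∫ ∫ f(w₁,w₂) G(1-s₁,w₁) G(s₁-s₂,w₁-w₂) G(s₂,w₂)`. -/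
noncomputable def In (n : ℕ)
    (f : EuclideanSpace ℝ (Fin n) × EuclideanSpace ℝ (Fin n) → ℝ) : ℝ :=
  ∫ s₁ in Set.Ioo (0:ℝ) 1, ∫ s₂ in Set.Ioo (0:ℝ) s₁,
    ∫ w₁ : EuclideanSpace ℝ (Fin n), ∫ w₂ : EuclideanSpace ℝ (Fin n),
      f (w₁, w₂) * heatG n (1 - s₁) w₁ * heatG n (s₁ - s₂) (w₁ - w₂) * heatG n s₂ w₂

lemma heatG_nonneg (n : ℕ) {t : ℝ} (ht : 0 ≤ t) (x : EuclideanSpace ℝ (Fin n)) :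
    0 ≤ heatG n t x := by
  unfold heatG
  positivity

lemma heatG_neg (n : ℕ) (t : ℝ) (x : EuclideanSpace ℝ (Fin n)) :
    heatG n t (-x) = heatG n t x := by
  simp [heatG]

lemma integral_heatG (n : ℕ) {t : ℝ} (ht : 0 < t) : ∫ x, heatG n t x = 1 := by
  have h := GaussianFourier.integral_rexp_neg_mul_sq_norm
    (V := EuclideanSpace ℝ (Fin n)) (b := 1 / (4 * t)) (by positivity)
  have e : ∀ x : EuclideanSpace ℝ (Fin n),
      heatG n t x = (4 * π * t) ^ (-(n : ℝ) / 2) * rexp (-(1 / (4 * t)) * ‖x‖ ^ 2) := by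
    intro x
    unfold heatG
    congr 2
    ring
  simp_rw [e]
  rw [integral_const_mul, h, finrank_euclideanSpace_fin,
    show π / (1 / (4 * t)) = 4 * π * t by field_simp, neg_div, ← rpow_add (by positivity)]
  simp

lemma integrable_heatG (n : ℕ) {t : ℝ} (ht : 0 < t) : Integrable (heatG n t) := by
  by_contra h
  have := integral_heatG n ht
  rw [integral_undef h] at this
  exact zero_ne_one this

lemma measurable_heatG (n : ℕ) :
    Measurable fun p : ℝ × EuclideanSpace ℝ (Fin n) => heatG n p.1 p.2 := by
  unfold heatG
  fun_prop

lemma heatG_le_of_third_le (n : ℕ) {t : ℝ} (ht : 1 / 3 ≤ t) (x : EuclideanSpace ℝ (Fin n)) :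
    heatG n t x ≤ (4 * π * (1 / 3)) ^ (-(n : ℝ) / 2) := by
  have ht0 : 0 < t := by linarith
  unfold heatG
  have h1 : (4 * π * t) ^ (-(n : ℝ) / 2) ≤ (4 * π * (1 / 3)) ^ (-(n : ℝ) / 2) :=
    rpow_le_rpow_of_nonpos (by positivity) (by gcongr)
      (by rw [neg_div]; exact neg_nonpos.2 (by positivity))
  have h2 : rexp (-‖x‖ ^ 2 / (4 * t)) ≤ 1 := by
    rw [exp_le_one_iff, neg_div]
    exact neg_nonpos.2 (by positivity)
  calc _ ≤ (4 * π * (1 / 3)) ^ (-(n : ℝ) / 2) * 1 := by gcongr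
    _ = _ := mul_one _

lemma heatG_eq_double (n : ℕ) {t : ℝ} (ht : 0 < t) (x : EuclideanSpace ℝ (Fin n)) :
    heatG n t x = 2 ^ ((n : ℝ) / 2) * heatG n (2 * t) x * rexp (-‖x‖ ^ 2 / (8 * t)) := by
  unfold heatG
  have h1 : rexp (-‖x‖ ^ 2 / (4 * t)) =
      rexp (-‖x‖ ^ 2 / (4 * (2 * t))) * rexp (-‖x‖ ^ 2 / (8 * t)) := by
    rw [← exp_add]
    congr 1
    field_simp
    ring
  have h2 : (4 * π * (2 * t)) ^ (-(n : ℝ) / 2) =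
      2 ^ (-((n : ℝ) / 2)) * (4 * π * t) ^ (-(n : ℝ) / 2) := by
    rw [show 4 * π * (2 * t) = 2 * (4 * π * t) by ring, mul_rpow (by norm_num) (by positivity),
      neg_div]
  have h3 : (2 : ℝ) ^ ((n : ℝ) / 2) * 2 ^ (-((n : ℝ) / 2)) = 1 := by
    rw [← rpow_add (by norm_num)]
    simp
  rw [h1, h2]
  linear_combination (-(4 * π * t) ^ (-(n : ℝ) / 2) * (rexp (-‖x‖ ^ 2 / (4 * (2 * t))) *
    rexp (-‖x‖ ^ 2 / (8 * t)))) * h3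

lemma heatG_le_double (n : ℕ) {t : ℝ} (ht : 0 < t) (x : EuclideanSpace ℝ (Fin n)) :
    heatG n t x ≤ 2 ^ ((n : ℝ) / 2) * heatG n (2 * t) x := by
  have h0 := heatG_nonneg n (t := 2 * t) (by linarith) x
  rw [heatG_eq_double n ht]
  refine mul_le_of_le_one_right (by positivity) ?_
  rw [exp_le_one_iff, neg_div]
  exact neg_nonpos.2 (by positivity)

lemma heatG_le_double_mul_exp (n : ℕ) {t : ℝ} (ht : 0 < t) (ht1 : t ≤ 1)
    (x : EuclideanSpace ℝ (Fin n)) :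
    heatG n t x ≤ 2 ^ ((n : ℝ) / 2) * heatG n (2 * t) x * rexp (-‖x‖ ^ 2 / 8) := by
  have h0 := heatG_nonneg n (t := 2 * t) (by linarith) x
  rw [heatG_eq_double n ht]
  gcongr _ * rexp ?_
  rw [neg_div, neg_div, neg_le_neg_iff]
  gcongr
  linarith

lemma one_add_pow_mul_exp_le (k : ℕ) {r : ℝ} (hr : 0 ≤ r) :
    (1 + r) ^ k * rexp (-r ^ 2 / 8) ≤ rexp (2 * (k : ℝ) ^ 2) := by
  have h1 : (1 + r) ^ k ≤ rexp (k * r) := by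
    rw [exp_nat_mul]
    gcongr
    linarith [add_one_le_exp r]
  calc _ ≤ rexp (k * r) * rexp (-r ^ 2 / 8) := by gcongr
    _ = rexp (k * r + -r ^ 2 / 8) := (exp_add _ _).symm
    _ ≤ _ := by
      gcongr
      nlinarith [sq_nonneg (r - 4 * k)]

lemma one_add_norm_pow_mul_exp_le {E : Type*} [SeminormedAddCommGroup E] (k : ℕ) (w : E × E) :
    (1 + ‖w‖) ^ k * (rexp (-‖w.1‖ ^ 2 / 8) * rexp (-‖w.2‖ ^ 2 / 8)) ≤
      rexp (2 * (k : ℝ) ^ 2) := by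
  refine le_trans ?_ (one_add_pow_mul_exp_le k (norm_nonneg w))
  rw [← exp_add]
  gcongr
  have : ‖w‖ ^ 2 ≤ ‖w.1‖ ^ 2 + ‖w.2‖ ^ 2 := by
    rw [Prod.norm_def]
    rcases max_cases ‖w.1‖ ‖w.2‖ with h | h <;> rw [h.1] <;>
      nlinarith [sq_nonneg ‖w.1‖, sq_nonneg ‖w.2‖]
  linarith

/-- The sum of the pairwise products of the three factors of the heat bridge density. -/
noncomputable def heatPairs (n : ℕ) (a b c : ℝ)
    (w : EuclideanSpace ℝ (Fin n) × EuclideanSpace ℝ (Fin n)) : ℝ :=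
  heatG n b (w.1 - w.2) * heatG n c w.2 + heatG n a w.1 * heatG n c w.2 +
    heatG n a w.1 * heatG n b (w.2 - w.1)

lemma integrable_heatG_sub_mul (n : ℕ) {b c : ℝ} (hb : 0 < b) (hc : 0 < c) :
    Integrable fun w : EuclideanSpace ℝ (Fin n) × EuclideanSpace ℝ (Fin n) =>
      heatG n b (w.1 - w.2) * heatG n c w.2 := by
  have hp := (integrable_heatG n hb).mul_prod (integrable_heatG n hc)
  exact (measurePreserving_sub_prod (volume : Measure (EuclideanSpace ℝ (Fin n)))
    volume).integrable_comp_of_integrable hp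

lemma integral_heatG_sub_mul (n : ℕ) {b c : ℝ} (hb : 0 < b) (hc : 0 < c) :
    ∫ w : EuclideanSpace ℝ (Fin n) × EuclideanSpace ℝ (Fin n),
      heatG n b (w.1 - w.2) * heatG n c w.2 = 1 := by
  have hi := integrable_heatG_sub_mul n hb hc
  rw [Measure.volume_eq_prod] at hi ⊢
  rw [integral_prod_symm _ hi]
  simp_rw [integral_mul_const, integral_sub_right_eq_self (heatG n b), integral_heatG n hb, one_mul,
    integral_heatG n hc]

lemma integrable_heatPairs (n : ℕ) {a b c : ℝ} (ha : 0 < a) (hb : 0 < b) (hc : 0 < c) :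
    Integrable (heatPairs n a b c) := by
  refine ((integrable_heatG_sub_mul n hb hc).add
    ((integrable_heatG n ha).mul_prod (integrable_heatG n hc))).add ?_
  refine (integrable_heatG_sub_mul n hb ha).swap.congr (.of_forall fun w => ?_)
  simp [mul_comm]

lemma integral_heatPairs (n : ℕ) {a b c : ℝ} (ha : 0 < a) (hb : 0 < b) (hc : 0 < c) :
    ∫ w, heatPairs n a b c w = 3 := by
  have h1 := integrable_heatG_sub_mul n hb hc
  have h2 := (integrable_heatG n ha).mul_prod (integrable_heatG n hc)
  have h3 := (integrable_heatG_sub_mul n hb ha).swap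
  have i3 := integral_prod_swap (μ := volume) (ν := volume)
    (fun w : EuclideanSpace ℝ (Fin n) × EuclideanSpace ℝ (Fin n) =>
      heatG n b (w.1 - w.2) * heatG n a w.2)
  have i1 := integral_heatG_sub_mul n hb hc
  have i2 := integral_prod_mul (μ := volume) (ν := volume) (heatG n a) (heatG n c)
  have i4 := integral_heatG_sub_mul n hb ha
  rw [integral_heatG n ha, integral_heatG n hc] at i2
  have e : heatPairs n a b c =
      ((fun w => heatG n b (w.1 - w.2) * heatG n c w.2) +
        fun w => heatG n a w.1 * heatG n c w.2) +
        (fun w => heatG n b (w.1 - w.2) * heatG n a w.2) ∘ Prod.swap := by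
    ext w
    simp [heatPairs, mul_comm]
  rw [Measure.volume_eq_prod] at *
  rw [e, integral_add' (h1.add h2) h3, integral_add' h1 h2, i1, i2]
  simp only [Function.comp_apply]
  rw [i3, i4]
  norm_num

lemma heatG_mul_mul_le_heatPairs (n : ℕ) {a b c : ℝ} (ha : 0 < a) (hb : 0 < b) (hc : 0 < c)
    (habc : 1 ≤ a + b + c) (w : EuclideanSpace ℝ (Fin n) × EuclideanSpace ℝ (Fin n)) :
    heatG n a w.1 * heatG n b (w.1 - w.2) * heatG n c w.2 ≤
      (4 * π * (1 / 3)) ^ (-(n : ℝ) / 2) * heatPairs n a b c w := by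
  have hM : 0 ≤ (4 * π * (1 / 3)) ^ (-(n : ℝ) / 2) := by positivity
  have h1 := heatG_nonneg n ha.le w.1
  have h2 := heatG_nonneg n hb.le (w.1 - w.2)
  have h3 := heatG_nonneg n hc.le w.2
  have h23 := mul_nonneg h2 h3
  have h13 := mul_nonneg h1 h3
  have h12 := mul_nonneg h1 h2
  have hs : heatPairs n a b c w = heatG n b (w.1 - w.2) * heatG n c w.2 +
      heatG n a w.1 * heatG n c w.2 + heatG n a w.1 * heatG n b (w.1 - w.2) := by
    rw [heatPairs, ← heatG_neg n b (w.2 - w.1), neg_sub]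
  rw [hs]
  obtain h | h | h : 1 / 3 ≤ a ∨ 1 / 3 ≤ b ∨ 1 / 3 ≤ c := by
    by_contra! h
    linarith
  · have := mul_le_mul_of_nonneg_right (heatG_le_of_third_le n h w.1) h23
    linarith [mul_nonneg hM h13, mul_nonneg hM h12]
  · have := mul_le_mul_of_nonneg_right (heatG_le_of_third_le n h (w.1 - w.2)) h13
    linarith [mul_nonneg hM h23, mul_nonneg hM h12]
  · have := mul_le_mul_of_nonneg_right (heatG_le_of_third_le n h w.2) h12
    linarith [mul_nonneg hM h23, mul_nonneg hM h13]

lemma exists_bound_mul_heatG (n : ℕ)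
    {f : EuclideanSpace ℝ (Fin n) × EuclideanSpace ℝ (Fin n) → ℝ}
    (hgrowth : ∃ (C : ℝ) (k : ℕ), ∀ w, |f w| ≤ C * (1 + ‖w‖) ^ k) :
    ∃ K : ℝ, ∀ a b c : ℝ, 0 < a → 0 < b → 0 < c → a + b + c = 1 → ∀ w,
      ‖f w * heatG n a w.1 * heatG n b (w.1 - w.2) * heatG n c w.2‖ ≤
        K * heatPairs n (2 * a) (2 * b) (2 * c) w := by
  obtain ⟨C, k, hC⟩ := hgrowth
  have hC0 : 0 ≤ C := by
    have := (abs_nonneg _).trans (hC 0)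
    simpa using this
  set D : ℝ := 2 ^ ((n : ℝ) / 2)
  refine ⟨C * rexp (2 * (k : ℝ) ^ 2) * D ^ 3 * (4 * π * (1 / 3)) ^ (-(n : ℝ) / 2), ?_⟩
  intro a b c ha hb hc habc w
  have hD : 0 ≤ D := by positivity
  have g1 := heatG_nonneg n ha.le w.1
  have g2 := heatG_nonneg n hb.le (w.1 - w.2)
  have g3 := heatG_nonneg n hc.le w.2
  have p1 := heatG_nonneg n (t := 2 * a) (by linarith) w.1
  have p2 := heatG_nonneg n (t := 2 * b) (by linarith) (w.1 - w.2)
  have p3 := heatG_nonneg n (t := 2 * c) (by linarith) w.2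
  have q1 := heatG_le_double_mul_exp n ha (by linarith) w.1
  have q2 := heatG_le_double n hb (w.1 - w.2)
  have q3 := heatG_le_double_mul_exp n hc (by linarith) w.2
  rw [norm_mul, norm_mul, norm_mul, norm_of_nonneg g1, norm_of_nonneg g2, norm_of_nonneg g3,
    norm_eq_abs]
  calc |f w| * heatG n a w.1 * heatG n b (w.1 - w.2) * heatG n c w.2
      ≤ (C * (1 + ‖w‖) ^ k) * (D * heatG n (2 * a) w.1 * rexp (-‖w.1‖ ^ 2 / 8)) *
        (D * heatG n (2 * b) (w.1 - w.2)) *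
        (D * heatG n (2 * c) w.2 * rexp (-‖w.2‖ ^ 2 / 8)) := by
        gcongr
        exact hC w
    _ = C * ((1 + ‖w‖) ^ k * (rexp (-‖w.1‖ ^ 2 / 8) * rexp (-‖w.2‖ ^ 2 / 8))) * D ^ 3 *
        (heatG n (2 * a) w.1 * heatG n (2 * b) (w.1 - w.2) * heatG n (2 * c) w.2) := by ring
    _ ≤ C * rexp (2 * (k : ℝ) ^ 2) * D ^ 3 *
        ((4 * π * (1 / 3)) ^ (-(n : ℝ) / 2) * heatPairs n (2 * a) (2 * b) (2 * c) w) := by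
        have hpairs := heatG_mul_mul_le_heatPairs n (a := 2 * a) (b := 2 * b) (c := 2 * c)
          (by linarith) (by linarith) (by linarith) (by linarith) w
        have hexp := one_add_norm_pow_mul_exp_le k w
        exact mul_le_mul (by gcongr) hpairs (by positivity) (by positivity)
    _ = _ := by ring

/-- The integrand of `In`. -/
noncomputable def bridgeIntegrand (n : ℕ)
    (f : EuclideanSpace ℝ (Fin n) × EuclideanSpace ℝ (Fin n) → ℝ) (s : ℝ × ℝ)
    (w : EuclideanSpace ℝ (Fin n) × EuclideanSpace ℝ (Fin n)) : ℝ :=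
  f w * heatG n (1 - s.1) w.1 * heatG n (s.1 - s.2) (w.1 - w.2) * heatG n s.2 w.2

lemma measurable_bridgeIntegrand (n : ℕ)
    {f : EuclideanSpace ℝ (Fin n) × EuclideanSpace ℝ (Fin n) → ℝ} (hf : Continuous f) :
    Measurable (Function.uncurry (bridgeIntegrand n f)) := by
  have hfm := hf.measurable
  have hG := measurable_heatG n
  have h1 : Measurable fun p : (ℝ × ℝ) × EuclideanSpace ℝ (Fin n) × EuclideanSpace ℝ (Fin n) =>
      heatG n (1 - p.1.1) p.2.1 :=
    hG.comp (by fun_prop : Measurable fun p : (ℝ × ℝ) × EuclideanSpace ℝ (Fin n) ×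
      EuclideanSpace ℝ (Fin n) => (1 - p.1.1, p.2.1))
  have h2 : Measurable fun p : (ℝ × ℝ) × EuclideanSpace ℝ (Fin n) × EuclideanSpace ℝ (Fin n) =>
      heatG n (p.1.1 - p.1.2) (p.2.1 - p.2.2) :=
    hG.comp (by fun_prop : Measurable fun p : (ℝ × ℝ) × EuclideanSpace ℝ (Fin n) ×
      EuclideanSpace ℝ (Fin n) => (p.1.1 - p.1.2, p.2.1 - p.2.2))
  have h3 : Measurable fun p : (ℝ × ℝ) × EuclideanSpace ℝ (Fin n) × EuclideanSpace ℝ (Fin n) =>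
      heatG n p.1.2 p.2.2 :=
    hG.comp (by fun_prop : Measurable fun p : (ℝ × ℝ) × EuclideanSpace ℝ (Fin n) ×
      EuclideanSpace ℝ (Fin n) => (p.1.2, p.2.2))
  exact (((hfm.comp measurable_snd).mul h1).mul h2).mul h3

/-- The open triangle of ordered times `0 < s₂ < s₁ < 1`. -/
def timeTriangle : Set (ℝ × ℝ) := {s | 0 < s.2 ∧ s.2 < s.1 ∧ s.1 < 1}

lemma measurableSet_timeTriangle : MeasurableSet timeTriangle :=
  (measurableSet_lt measurable_const measurable_snd).inter
    ((measurableSet_lt measurable_snd measurable_fst).inter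
      (measurableSet_lt measurable_fst measurable_const))

lemma volume_timeTriangle_lt_top : volume timeTriangle < ⊤ := by
  refine (measure_mono (t := Set.Icc (0 : ℝ) 1 ×ˢ Set.Icc (0 : ℝ) 1) ?_).trans_lt
    (isCompact_Icc.prod isCompact_Icc).measure_lt_top
  rintro ⟨s₁, s₂⟩ ⟨h1, h2, h3⟩
  simp only at h1 h2 h3
  exact ⟨⟨by linarith, by linarith⟩, ⟨by linarith, by linarith⟩⟩

lemma integrable_bridgeIntegrand (n : ℕ)
    {f : EuclideanSpace ℝ (Fin n) × EuclideanSpace ℝ (Fin n) → ℝ} (hf : Continuous f)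
    (hgrowth : ∃ (C : ℝ) (k : ℕ), ∀ w, |f w| ≤ C * (1 + ‖w‖) ^ k) {s : ℝ × ℝ}
    (hs : s ∈ timeTriangle) : Integrable (bridgeIntegrand n f s) := by
  obtain ⟨K, hK⟩ := exists_bound_mul_heatG n hgrowth
  obtain ⟨h1, h2, h3⟩ := hs
  refine ((integrable_heatPairs n (a := 2 * (1 - s.1)) (b := 2 * (s.1 - s.2)) (c := 2 * s.2)
    (by linarith) (by linarith) (by linarith)).const_mul K).mono' ?_ (.of_forall fun w => ?_)
  · exact ((measurable_bridgeIntegrand n hf).comp measurable_prodMk_left).aestronglyMeasurable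
  · exact hK _ _ _ (by linarith) (by linarith) (by linarith) (by ring) w

lemma integrableOn_integral_bridgeIntegrand (n : ℕ)
    {f : EuclideanSpace ℝ (Fin n) × EuclideanSpace ℝ (Fin n) → ℝ} (hf : Continuous f)
    (hgrowth : ∃ (C : ℝ) (k : ℕ), ∀ w, |f w| ≤ C * (1 + ‖w‖) ^ k) :
    IntegrableOn (fun s => ∫ w, bridgeIntegrand n f s w) timeTriangle := by
  obtain ⟨K, hK⟩ := exists_bound_mul_heatG n hgrowth
  refine Measure.integrableOn_of_bounded (M := K * 3) volume_timeTriangle_lt_top.ne ?_ ?_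
  · exact (measurable_bridgeIntegrand n hf).stronglyMeasurable.integral_prod_right'
      |>.aestronglyMeasurable
  · refine (ae_restrict_iff' measurableSet_timeTriangle).2 (.of_forall fun s hs => ?_)
    obtain ⟨h1, h2, h3⟩ := hs
    have ha : 0 < 2 * (1 - s.1) := by linarith
    have hb : 0 < 2 * (s.1 - s.2) := by linarith
    have hc : 0 < 2 * s.2 := by linarith
    rw [← integral_heatPairs n ha hb hc, ← integral_const_mul]
    refine norm_integral_le_of_norm_le ((integrable_heatPairs n ha hb hc).const_mul K)
      (.of_forall fun w => ?_)
    exact hK _ _ _ (by linarith) (by linarith) (by linarith) (by ring) w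

lemma integral_bridgeIntegrand_swap (n : ℕ)
    (f : EuclideanSpace ℝ (Fin n) × EuclideanSpace ℝ (Fin n) → ℝ) (s₁ s₂ : ℝ) :
    ∫ w, bridgeIntegrand n (fun w => f (w.2, w.1)) (s₁, s₂) w =
      ∫ w, bridgeIntegrand n f (1 - s₂, 1 - s₁) w := by
  have h := integral_prod_swap (μ := volume) (ν := volume) (bridgeIntegrand n f (1 - s₂, 1 - s₁))
  rw [Measure.volume_eq_prod, ← h]
  congr 1
  ext w
  simp only [bridgeIntegrand, Prod.fst_swap, Prod.snd_swap]
  rw [← heatG_neg n _ (w.2 - w.1), neg_sub, show 1 - (1 - s₂) = s₂ by ring,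
    show 1 - s₂ - (1 - s₁) = s₁ - s₂ by ring, Prod.swap]
  ring

lemma In_eq_integral_indicator (n : ℕ)
    {f : EuclideanSpace ℝ (Fin n) × EuclideanSpace ℝ (Fin n) → ℝ} (hf : Continuous f)
    (hgrowth : ∃ (C : ℝ) (k : ℕ), ∀ w, |f w| ≤ C * (1 + ‖w‖) ^ k) :
    In n f = ∫ s₁, ∫ s₂, timeTriangle.indicator
      (fun s => ∫ w, bridgeIntegrand n f s w) (s₁, s₂) := by
  rw [In, ← integral_indicator measurableSet_Ioo]
  congr 1
  ext s₁
  by_cases h1 : s₁ ∈ Set.Ioo (0 : ℝ) 1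
  · rw [Set.indicator_of_mem h1, ← integral_indicator measurableSet_Ioo]
    congr 1
    ext s₂
    by_cases h2 : s₂ ∈ Set.Ioo (0 : ℝ) s₁
    · have hs : (s₁, s₂) ∈ timeTriangle := ⟨h2.1, h2.2, h1.2⟩
      rw [Set.indicator_of_mem h2, Set.indicator_of_mem hs]
      exact (integral_prod _ (integrable_bridgeIntegrand n hf hgrowth hs)).symm
    · rw [Set.indicator_of_notMem h2, Set.indicator_of_notMem fun hs => h2 ⟨hs.1, hs.2.1⟩]
  · rw [Set.indicator_of_notMem h1]
    refine (integral_eq_zero_of_ae (.of_forall fun s₂ => ?_)).symm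
    exact Set.indicator_of_notMem (fun hs => h1 ⟨hs.1.trans hs.2.1, hs.2.2⟩) _

/-- Mirror symmetry: `Iₙ(f) = Iₙ(Sf)` where `Sf(w₁,w₂) = f(w₂,w₁)`. -/
theorem In_mirror_symm (n : ℕ)
    (f : EuclideanSpace ℝ (Fin n) × EuclideanSpace ℝ (Fin n) → ℝ)
    (hf : Continuous f)
    (hgrowth : ∃ (C : ℝ) (k : ℕ), ∀ w, |f w| ≤ C * (1 + ‖w‖) ^ k) :
    In n f = In n (fun w => f (w.2, w.1)) := by
  have hgrowth' : ∃ (C : ℝ) (k : ℕ), ∀ w : EuclideanSpace ℝ (Fin n) × EuclideanSpace ℝ (Fin n),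
      |f (w.2, w.1)| ≤ C * (1 + ‖w‖) ^ k := by
    obtain ⟨C, k, hC⟩ := hgrowth
    refine ⟨C, k, fun w => ?_⟩
    have := hC (w.2, w.1)
    rwa [Prod.norm_def, max_comm] at this
  rw [In_eq_integral_indicator n hf hgrowth,
    In_eq_integral_indicator n (f := fun w => f (w.2, w.1)) (by fun_prop) hgrowth']
  set Ψ : ℝ × ℝ → ℝ := timeTriangle.indicator (fun s => ∫ w, bridgeIntegrand n f s w) with hΨ
  have hint : Integrable Ψ :=
    (integrable_indicator_iff measurableSet_timeTriangle).2
      (integrableOn_integral_bridgeIntegrand n hf hgrowth)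
  have key : ∀ s₁ s₂ : ℝ, timeTriangle.indicator
      (fun s => ∫ w, bridgeIntegrand n (fun w => f (w.2, w.1)) s w) (s₁, s₂) =
        Ψ (1 - s₂, 1 - s₁) := by
    intro s₁ s₂
    have hmem : (s₁, s₂) ∈ timeTriangle ↔ (1 - s₂, 1 - s₁) ∈ timeTriangle := by
      simp only [timeTriangle, Set.mem_ofPred_eq]
      constructor <;> rintro ⟨h1, h2, h3⟩ <;> refine ⟨?_, ?_, ?_⟩ <;> linarith
    by_cases hs : (s₁, s₂) ∈ timeTriangle
    · rw [hΨ, Set.indicator_of_mem hs, Set.indicator_of_mem (hmem.1 hs),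
        integral_bridgeIntegrand_swap]
    · rw [hΨ, Set.indicator_of_notMem hs, Set.indicator_of_notMem (mt hmem.2 hs)]
  calc ∫ s₁, ∫ s₂, Ψ (s₁, s₂) = ∫ s₂, ∫ s₁, Ψ (s₁, s₂) :=
        integral_integral_swap (f := fun s₁ s₂ => Ψ (s₁, s₂)) hint
    _ = ∫ s₁, ∫ s₂, Ψ (s₂, 1 - s₁) :=
        (integral_sub_left_eq_self (fun s => ∫ s₂, Ψ (s₂, s)) volume 1).symm
    _ = ∫ s₁, ∫ s₂, Ψ (1 - s₂, 1 - s₁) := by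
        congr 1
        ext s₁
        exact (integral_sub_left_eq_self (fun s => Ψ (s, 1 - s₁)) volume 1).symm
    _ = _ := by simp_rw [key]
end

section
/- For all integers α ≥ 2, β ≥ 1 and all real numbers s_1, s_2 with 0 < s_2 < s_1 < 1, it holds that I_{α,β}(s_1,s_2) = 2(1-s_1) [ (α-1) s_1 I_{α-2,β}(s_1,s_2) + β s_2 I_{α-1,β-1}(s_1,s_2) ]. -/
open MeasureTheory Real

/-- One-dimensional Gaussian heat kernel. -/
noncomputable def g1 (t x : ℝ) : ℝ :=
  (4 * Real.pi * t) ^ (-(1 : ℝ) / 2) * Real.exp (-x ^ 2 / (4 * t))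

/-- `I_{α,β}(s₁,s₂) = ∫∫ x^α y^β g(1-s₁,x) g(s₁-s₂,x-y) g(s₂,y) dx dy`. -/
noncomputable def Iab (α β : ℕ) (s₁ s₂ : ℝ) : ℝ :=
  ∫ x : ℝ, ∫ y : ℝ, x ^ α * y ^ β * g1 (1 - s₁) x * g1 (s₁ - s₂) (x - y) * g1 s₂ y

lemma g1_nonneg {t : ℝ} (ht : 0 < t) (x : ℝ) : 0 ≤ g1 t x := by
  unfold g1
  positivity

lemma g1_le {t : ℝ} (ht : 0 < t) (x : ℝ) : g1 t x ≤ (4 * π * t) ^ (-(1 : ℝ) / 2) := by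
  unfold g1
  refine mul_le_of_le_one_right (by positivity) (Real.exp_le_one_iff.2 ?_)
  exact div_nonpos_of_nonpos_of_nonneg (neg_nonpos.2 (sq_nonneg x)) (by positivity)

lemma hasDerivAt_g1 {t : ℝ} (ht : t ≠ 0) (x : ℝ) :
    HasDerivAt (g1 t) (-(x / (2 * t)) * g1 t x) x := by
  have h := ((((hasDerivAt_pow 2 x).neg.div_const (4 * t)).exp).const_mul
    ((4 * π * t) ^ (-(1 : ℝ) / 2)))
  refine h.congr_deriv ?_
  simp only [g1, Pi.neg_apply]
  field_simp
  push_cast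
  ring

lemma continuous_g1 (t : ℝ) : Continuous (g1 t) := by
  unfold g1
  fun_prop

lemma integrable_pow_mul_g1 {t : ℝ} (ht : 0 < t) (n : ℕ) :
    Integrable fun x : ℝ ↦ x ^ n * g1 t x := by
  have h := (integrable_rpow_mul_exp_neg_mul_sq (b := (4 * t)⁻¹) (by positivity)
    (s := n) (by linarith [n.cast_nonneg (α := ℝ)])).const_mul ((4 * π * t) ^ (-(1 : ℝ) / 2))
  refine h.congr (.of_forall fun x ↦ ?_)
  have hx : -x ^ 2 / (4 * t) = -(4 * t)⁻¹ * x ^ 2 := by ring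
  simp only [g1, rpow_natCast, hx]
  ring

/-- The joint density of three heat-kernel increments of lengths `a`, `b`, `c`. -/
noncomputable def heatPath (a b c : ℝ) (p : ℝ × ℝ) : ℝ :=
  g1 a p.1 * g1 b (p.1 - p.2) * g1 c p.2

lemma integrable_monomial_mul_heatPath {a b c : ℝ} (ha : 0 < a) (hb : 0 < b) (hc : 0 < c)
    (m n : ℕ) : Integrable fun p : ℝ × ℝ ↦ p.1 ^ m * p.2 ^ n * heatPath a b c p := by
  have h := (integrable_pow_mul_g1 ha m).mul_prod (integrable_pow_mul_g1 hc n)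
  have hb' : Continuous fun p : ℝ × ℝ ↦ g1 b (p.1 - p.2) :=
    (continuous_g1 b).comp (continuous_fst.sub continuous_snd)
  refine (h.bdd_mul (c := (4 * π * b) ^ (-(1 : ℝ) / 2)) hb'.aestronglyMeasurable
    (.of_forall fun p ↦ ?_)).congr (.of_forall fun p ↦ ?_)
  · rw [Real.norm_of_nonneg (g1_nonneg hb _)]
    exact g1_le hb _
  · simp only [heatPath]
    ring

lemma Iab_eq_integral_heatPath {s₁ s₂ : ℝ} (h₀ : 0 < s₂) (h₁ : s₂ < s₁) (h₂ : s₁ < 1)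
    (m n : ℕ) : Iab m n s₁ s₂ =
      ∫ p : ℝ × ℝ, p.1 ^ m * p.2 ^ n * heatPath (1 - s₁) (s₁ - s₂) s₂ p := by
  rw [Measure.volume_eq_prod, integral_prod _ (integrable_monomial_mul_heatPath
    (sub_pos.2 h₂) (sub_pos.2 h₁) h₀ m n)]
  simp only [Iab, heatPath, mul_assoc]

lemma hasLineDerivAt_heatPath {s₁ s₂ : ℝ} (h₀ : s₂ ≠ 0) (h₁ : s₁ - s₂ ≠ 0)
    (h₂ : 1 - s₁ ≠ 0) (p : ℝ × ℝ) :
    HasLineDerivAt ℝ (heatPath (1 - s₁) (s₁ - s₂) s₂)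
      (-(p.1 / (2 * (1 - s₁))) * heatPath (1 - s₁) (s₁ - s₂) s₂ p) p (s₁, s₂) := by
  have hx : HasDerivAt (fun t : ℝ ↦ p.1 + t * s₁) s₁ 0 := by
    simpa using ((hasDerivAt_id (0 : ℝ)).mul_const s₁).const_add p.1
  have hy : HasDerivAt (fun t : ℝ ↦ p.2 + t * s₂) s₂ 0 := by
    simpa using ((hasDerivAt_id (0 : ℝ)).mul_const s₂).const_add p.2
  have h := (((hasDerivAt_g1 h₂ _).comp 0 hx).mul
    ((hasDerivAt_g1 h₁ _).comp 0 (hx.sub hy))).mul ((hasDerivAt_g1 h₀ _).comp 0 hy)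
  refine HasDerivAt.congr_deriv h ?_
  simp only [heatPath, Function.comp_apply, Pi.mul_apply, Pi.sub_apply, zero_mul, add_zero]
  field_simp
  ring

lemma hasLineDerivAt_monomial (k m : ℕ) (p v : ℝ × ℝ) :
    HasLineDerivAt ℝ (fun q : ℝ × ℝ ↦ q.1 ^ (k + 1) * q.2 ^ (m + 1))
      ((k + 1) * v.1 * (p.1 ^ k * p.2 ^ (m + 1)) + (m + 1) * v.2 * (p.1 ^ (k + 1) * p.2 ^ m))
      p v := by
  have hx : HasDerivAt (fun t : ℝ ↦ p.1 + t * v.1) v.1 0 := by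
    simpa using ((hasDerivAt_id (0 : ℝ)).mul_const v.1).const_add p.1
  have hy : HasDerivAt (fun t : ℝ ↦ p.2 + t * v.2) v.2 0 := by
    simpa using ((hasDerivAt_id (0 : ℝ)).mul_const v.2).const_add p.2
  refine HasDerivAt.congr_deriv ((hx.pow (k + 1)).mul (hy.pow (m + 1))) ?_
  simp
  ring

theorem Iab_rec_iii (α β : ℕ) (hα : 2 ≤ α) (hβ : 1 ≤ β)
    (s₁ s₂ : ℝ) (h₀ : 0 < s₂) (h₁ : s₂ < s₁) (h₂ : s₁ < 1) :
    Iab α β s₁ s₂ =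
      2 * (1 - s₁) *
        (((α : ℝ) - 1) * s₁ * Iab (α - 2) β s₁ s₂ +
          (β : ℝ) * s₂ * Iab (α - 1) (β - 1) s₁ s₂) := by
  obtain ⟨k, rfl⟩ := Nat.exists_eq_add_of_le' hα
  obtain ⟨m, rfl⟩ := Nat.exists_eq_add_of_le' hβ
  have ha : 0 < 1 - s₁ := sub_pos.2 h₂
  have hb : 0 < s₁ - s₂ := sub_pos.2 h₁
  have hI := integrable_monomial_mul_heatPath ha hb h₀
  have hL (p : ℝ × ℝ) : ((k + 1) * s₁ * (p.1 ^ k * p.2 ^ (m + 1)) +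
        (m + 1) * s₂ * (p.1 ^ (k + 1) * p.2 ^ m)) * heatPath (1 - s₁) (s₁ - s₂) s₂ p =
      (k + 1) * s₁ * (p.1 ^ k * p.2 ^ (m + 1) * heatPath (1 - s₁) (s₁ - s₂) s₂ p) +
        (m + 1) * s₂ * (p.1 ^ (k + 1) * p.2 ^ m * heatPath (1 - s₁) (s₁ - s₂) s₂ p) := by
    ring
  have hR (p : ℝ × ℝ) : p.1 ^ (k + 1) * p.2 ^ (m + 1) *
        (-(p.1 / (2 * (1 - s₁))) * heatPath (1 - s₁) (s₁ - s₂) s₂ p) =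
      -(2 * (1 - s₁))⁻¹ *
        (p.1 ^ (k + 2) * p.2 ^ (m + 1) * heatPath (1 - s₁) (s₁ - s₂) s₂ p) := by
    ring
  have hi₁ := (hI k (m + 1)).const_mul ((k + 1) * s₁)
  have hi₂ := (hI (k + 1) m).const_mul ((m + 1) * s₂)
  have key := integral_bilinear_hasLineDerivAt_right_eq_neg_left_of_integrable
    (μ := (volume : Measure (ℝ × ℝ))) (v := (s₁, s₂)) (B := ContinuousLinearMap.mul ℝ ℝ)
    (f := fun q : ℝ × ℝ ↦ q.1 ^ (k + 1) * q.2 ^ (m + 1))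
    (g := heatPath (1 - s₁) (s₁ - s₂) s₂)
    ((hi₁.add hi₂).congr (.of_forall fun p ↦ (hL p).symm))
    (((hI (k + 2) (m + 1)).const_mul _).congr (.of_forall fun p ↦ (hR p).symm))
    (hI (k + 1) (m + 1))
    (fun p _ ↦ hasLineDerivAt_monomial k m p _)
    (fun p _ ↦ hasLineDerivAt_heatPath h₀.ne' hb.ne' ha.ne' p)
  simp only [ContinuousLinearMap.mul_apply', hL, hR] at key
  rw [integral_add hi₁ hi₂] at key
  simp only [integral_const_mul, ← Iab_eq_integral_heatPath h₀ h₁ h₂] at key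
  have hα' : k + 2 - 1 = k + 1 := rfl
  simp only [Nat.add_sub_cancel, hα']
  push_cast
  field_simp at key
  linarith
end

section
/- Let Ω ⊂ ℝ^n be a bounded open set and let V ∈ C_0^∞(Ω) be real-valued. Then 𝒫_6(V) = -((4π)^{-n/2} / 6) ( (1/2) ∫_Ω |∇V(x)|² dx + ∫_Ω V(x)³ dx ). -/
open MeasureTheory Real

/-- The simplex `{0 < s_m < … < s_1 < 1}` (indices listed in decreasing order). -/
def simplex (m : ℕ) : Set (Fin m → ℝ) :=
  {s | StrictAnti s ∧ ∀ k, s k ∈ Set.Ioo (0 : ℝ) 1}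

/-- `fnext s k = s (k+1)`, with the convention that it is `0` past the last index. -/
def fnext {m : ℕ} {E : Type*} [Zero E] (s : Fin m → E) (k : Fin m) : E :=
  if h : (k : ℕ) + 1 < m then s ⟨(k : ℕ) + 1, h⟩ else 0

/-- The coefficient `c_{αʲ}` associated with a `(j+1)`-tuple `α` of multi-indices in `ℕⁿ`
(a tuple of length `j+1`, so that tuples of every length `≥ 1` are covered). -/
noncomputable def cCoeff (n j : ℕ) (α : Fin (j + 1) → Fin n → ℕ) : ℝ :=
  (∏ k, ∏ i, (Nat.factorial (α k i) : ℝ))⁻¹ *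
    ∫ w : Fin (j + 1) → EuclideanSpace ℝ (Fin n),
      ∫ s in simplex (j + 1),
        (∏ k, ∏ i, w k i ^ α k i) *
          (heatG n (1 - s 0) (w 0) *
            ∏ k, heatG n (s k - fnext s k) (w k - fnext w k))

/-- Partial derivative in the `i`-th coordinate direction. -/
noncomputable def pderiv1 {n : ℕ} (i : Fin n) (f : EuclideanSpace ℝ (Fin n) → ℝ) :
    EuclideanSpace ℝ (Fin n) → ℝ :=
  fun x => fderiv ℝ f x (EuclideanSpace.single i 1)

/-- The multi-index partial derivative `∂^α f`. -/
noncomputable def mderiv {n : ℕ} (α : Fin n → ℕ) (f : EuclideanSpace ℝ (Fin n) → ℝ) :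
    EuclideanSpace ℝ (Fin n) → ℝ :=
  ((List.ofFn fun i : Fin n => (pderiv1 i)^[α i]).foldr (· ∘ ·) id) f

/-- `P_{αʲ}(V) = ∫_Ω ∏_k ∂^{α_k} V`. -/
noncomputable def Pcoef (n j : ℕ) (Ω : Set (EuclideanSpace ℝ (Fin n)))
    (α : Fin (j + 1) → Fin n → ℕ) (V : EuclideanSpace ℝ (Fin n) → ℝ) : ℝ :=
  ∫ x in Ω, ∏ k, mderiv (α k) V x

/-- `P_{2ℓ}(V) = Σ_{j=1}^{ℓ} (-1)^j Σ_{|αʲ| = 2ℓ-2j} c_{αʲ} P_{αʲ}(V)`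
(the inner sum, over the finitely many tuples of multi-indices of total order `2ℓ-2j`,
is written as a `tsum` over all tuples with an indicator). -/
noncomputable def Pscr (n : ℕ) (Ω : Set (EuclideanSpace ℝ (Fin n))) (ℓ : ℕ)
    (V : EuclideanSpace ℝ (Fin n) → ℝ) : ℝ :=
  ∑ m ∈ Finset.range ℓ,
    (-1 : ℝ) ^ (m + 1) *
      ∑' α : Fin (m + 1) → Fin n → ℕ,
        if (∑ k, ∑ i, α k i) = 2 * ℓ - 2 * (m + 1) then
          cCoeff n m α * Pcoef n m Ω α V else 0

/-- `f` is integrable for the volume measure, with integral `a`. -/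
def HasVolumeIntegral {X : Type*} [MeasureSpace X] (f : X → ℝ) (a : ℝ) : Prop :=
  Integrable f ∧ ∫ x, f x = a

namespace HasVolumeIntegral

variable {X Y : Type*} [MeasureSpace X] [MeasureSpace Y] {f g : X → ℝ} {a b : ℝ}

lemma add (hf : HasVolumeIntegral f a) (hg : HasVolumeIntegral g b) :
    HasVolumeIntegral (fun x => f x + g x) (a + b) :=
  ⟨hf.1.add hg.1, by rw [integral_add hf.1 hg.1, hf.2, hg.2]⟩

lemma const_mul (hf : HasVolumeIntegral f a) (c : ℝ) :
    HasVolumeIntegral (fun x => c * f x) (c * a) :=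
  ⟨hf.1.const_mul c, by rw [integral_const_mul, hf.2]⟩

lemma congr (hf : HasVolumeIntegral f a) (hfg : ∀ x, g x = f x) (hab : b = a) :
    HasVolumeIntegral g b := by
  obtain rfl : g = f := funext hfg
  exact hab ▸ hf

lemma comp_equiv {f : Y → ℝ} (hf : HasVolumeIntegral f a) {e : X ≃ᵐ Y}
    (he : MeasurePreserving e) : HasVolumeIntegral (fun x => f (e x)) a :=
  ⟨(he.integrable_comp_emb e.measurableEmbedding).2 hf.1, by rw [he.integral_comp', hf.2]⟩

lemma prod_mul [SFinite (volume : Measure X)] [SFinite (volume : Measure Y)] {h : Y → ℝ}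
    (hf : HasVolumeIntegral f a) (hh : HasVolumeIntegral h b) :
    HasVolumeIntegral (fun p : X × Y => f p.1 * h p.2) (a * b) :=
  ⟨hf.1.mul_prod hh.1, by rw [Measure.volume_eq_prod, integral_prod_mul, hf.2, hh.2]⟩

lemma euclidean_prod {n : ℕ} {f : Fin n → ℝ → ℝ} {a : Fin n → ℝ}
    (hf : ∀ i, HasVolumeIntegral (f i) (a i)) :
    HasVolumeIntegral (fun x : EuclideanSpace ℝ (Fin n) => ∏ i, f i (x i)) (∏ i, a i) := by
  have h : HasVolumeIntegral (fun x : Fin n → ℝ => ∏ i, f i (x i)) (∏ i, a i) :=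
    ⟨Integrable.fintype_prod fun i => (hf i).1, by
      rw [integral_fintype_prod_volume_eq_prod]
      exact Finset.prod_congr rfl fun i _ => (hf i).2⟩
  exact h.comp_equiv (EuclideanSpace.volume_preserving_symm_measurableEquiv_toLp (Fin n))

end HasVolumeIntegral

lemma heatG_eq_prod (n : ℕ) {c : ℝ} (hc : 0 < c) (x : EuclideanSpace ℝ (Fin n)) :
    heatG n c x = ∏ i, ProbabilityTheory.gaussianPDFReal 0 (2 * c).toNNReal (x i) := by
  have h0 : 0 < 4 * π * c := by positivity
  simp only [ProbabilityTheory.gaussianPDFReal, Finset.prod_mul_distrib, Finset.prod_const,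
    Finset.card_univ, Fintype.card_fin, ← Real.exp_sum, heatG, EuclideanSpace.norm_sq_eq,
    Real.coe_toNNReal _ (by positivity : 0 ≤ 2 * c), Real.norm_eq_abs, sq_abs, sub_zero,
    ← Finset.sum_div, Finset.sum_neg_distrib]
  rw [show 2 * π * (2 * c) = 4 * π * c by ring, show 2 * (2 * c) = 4 * c by ring,
    Real.sqrt_eq_rpow, ← Real.rpow_neg h0.le, ← Real.rpow_natCast, ← Real.rpow_mul h0.le,
    show -(1 / 2) * (n : ℝ) = -n / 2 by ring]

open ProbabilityTheory in
lemma hasVolumeIntegral_pow_mul_gaussianPDFReal {v : NNReal} (hv : v ≠ 0) (k : ℕ) :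
    HasVolumeIntegral (fun y => y ^ k * gaussianPDFReal 0 v y)
      (∫ y, y ^ k ∂gaussianReal 0 v) := by
  constructor
  · have h : Integrable (fun y : ℝ => y ^ k) (gaussianReal 0 v) := by
      rcases eq_or_ne k 0 with rfl | hk
      · simp
      · have := (memLp_id_gaussianReal (μ := 0) (v := v) k).integrable_norm_pow hk
        refine (this.mono' (by fun_prop) (.of_forall fun x => ?_))
        simp
    rw [gaussianReal_of_var_ne_zero _ hv, integrable_withDensity_iff_integrable_smul'
      (measurable_gaussianPDF 0 v) (.of_forall fun _ => gaussianPDF_lt_top)] at h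
    refine h.congr (.of_forall fun x => ?_)
    simp [toReal_gaussianPDF, mul_comm]
  · rw [integral_gaussianReal_eq_integral_smul hv]
    simp [mul_comm]

open ProbabilityTheory in
lemma integral_sq_gaussianReal (v : NNReal) : ∫ y, y ^ 2 ∂gaussianReal 0 v = v := by
  rw [← variance_id_gaussianReal (μ := 0) (v := v), variance_of_integral_eq_zero aemeasurable_id]
  · rfl
  · simp

open ProbabilityTheory in
lemma hasVolumeIntegral_pow_mul_heatG (n : ℕ) {c : ℝ} (hc : 0 < c) (i : Fin n) (k : ℕ) :
    HasVolumeIntegral (fun x : EuclideanSpace ℝ (Fin n) => x i ^ k * heatG n c x)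
      (∫ y, y ^ k ∂gaussianReal 0 (2 * c).toNNReal) := by
  have hv : (2 * c).toNNReal ≠ 0 := by simpa using hc
  have h := HasVolumeIntegral.euclidean_prod (n := n)
    (fun j => hasVolumeIntegral_pow_mul_gaussianPDFReal hv (if j = i then k else 0))
  refine h.congr (fun x => ?_) ?_
  · rw [heatG_eq_prod n hc, Finset.prod_mul_distrib]
    simp [pow_ite]
  · rw [Finset.prod_eq_single i (fun j _ hj => by simp [hj]) (by simp)]
    simp

lemma hasVolumeIntegral_heatG (n : ℕ) {c : ℝ} (hc : 0 < c) :
    HasVolumeIntegral (heatG n c) 1 := by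
  have hv : (2 * c).toNNReal ≠ 0 := by simpa using hc
  have h := HasVolumeIntegral.euclidean_prod (n := n)
    (fun _ => hasVolumeIntegral_pow_mul_gaussianPDFReal hv 0)
  exact h.congr (fun x => by simp [heatG_eq_prod n hc]) (by simp)

lemma hasVolumeIntegral_coord_mul_heatG (n : ℕ) {c : ℝ} (hc : 0 < c) (i : Fin n) :
    HasVolumeIntegral (fun x : EuclideanSpace ℝ (Fin n) => x i * heatG n c x) 0 :=
  (hasVolumeIntegral_pow_mul_heatG n hc i 1).congr (by simp) (by simp)

lemma hasVolumeIntegral_coord_sq_mul_heatG (n : ℕ) {c : ℝ} (hc : 0 < c) (i : Fin n) :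
    HasVolumeIntegral (fun x : EuclideanSpace ℝ (Fin n) => x i ^ 2 * heatG n c x) (2 * c) := by
  refine (hasVolumeIntegral_pow_mul_heatG n hc i 2).congr (by simp) ?_
  rw [integral_sq_gaussianReal, Real.coe_toNNReal _ (by positivity)]

/-- Completing the square in a product of two heat kernels. -/
lemma heatG_mul_heatG_sub (n : ℕ) {a b : ℝ} (ha : 0 < a) (hb : 0 < b)
    (x y : EuclideanSpace ℝ (Fin n)) :
    heatG n a x * heatG n b (x - y) =
      heatG n (a * b / (a + b)) (x - (a / (a + b)) • y) * heatG n (a + b) y := by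
  have hπ := Real.pi_pos
  have h1 : -‖x‖ ^ 2 / (4 * a) + -‖x - y‖ ^ 2 / (4 * b) =
      -‖x - (a / (a + b)) • y‖ ^ 2 / (4 * (a * b / (a + b))) + -‖y‖ ^ 2 / (4 * (a + b)) := by
    rw [norm_sub_sq_real, norm_sub_sq_real, norm_smul, inner_smul_right, Real.norm_eq_abs, mul_pow,
      sq_abs]
    field_simp
    ring
  have h2 : (4 * π * a) ^ (-(n : ℝ) / 2) * (4 * π * b) ^ (-(n : ℝ) / 2) =
      (4 * π * (a * b / (a + b))) ^ (-(n : ℝ) / 2) * (4 * π * (a + b)) ^ (-(n : ℝ) / 2) := by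
    rw [← Real.mul_rpow (by positivity) (by positivity),
      ← Real.mul_rpow (by positivity) (by positivity)]
    congr 1
    field_simp
  unfold heatG
  rw [mul_mul_mul_comm, mul_mul_mul_comm ((4 * π * (a * b / (a + b))) ^ _), h2, ← Real.exp_add,
    ← Real.exp_add, h1]

/-- Integrating out the first of several variables that enters as a translate. -/
lemma HasVolumeIntegral.layer {n m : ℕ} {ψ : EuclideanSpace ℝ (Fin n) → ℝ}
    {Φ : (Fin (m + 1) → EuclideanSpace ℝ (Fin n)) → ℝ} {a b : ℝ}
    (hψ : HasVolumeIntegral ψ a) (hΦ : HasVolumeIntegral Φ b) (κ : ℝ) :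
    HasVolumeIntegral (fun w : Fin (m + 2) → EuclideanSpace ℝ (Fin n) =>
      ψ (w 0 - κ • w 1) * Φ (Fin.tail w)) (a * b) := by
  have hmp : MeasurePreserving
      (fun p : (Fin (m + 1) → EuclideanSpace ℝ (Fin n)) × EuclideanSpace ℝ (Fin n) =>
        (p.1, p.2 - κ • p.1 0)) (volume.prod volume) (volume.prod volume) :=
    (MeasurePreserving.id volume).skew_product
      (g := fun (w : Fin (m + 1) → EuclideanSpace ℝ (Fin n)) x => x - κ • w 0)
      (by unfold Function.uncurry; fun_prop)
      (.of_forall fun w => (measurePreserving_sub_right volume (κ • w 0)).map_eq)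
  have h := hΦ.prod_mul hψ
  have h' : HasVolumeIntegral (fun p : (Fin (m + 1) → EuclideanSpace ℝ (Fin n)) ×
      EuclideanSpace ℝ (Fin n) => Φ p.1 * ψ (p.2 - κ • p.1 0)) (b * a) := by
    have hm := h.1.aestronglyMeasurable
    rw [Measure.volume_eq_prod] at hm
    refine ⟨(hmp.integrable_comp hm).2 h.1, ?_⟩
    refine (integral_map hmp.measurable.aemeasurable (by rwa [hmp.map_eq])).symm.trans ?_
    rw [hmp.map_eq]
    exact h.2
  have hs : MeasurePreserving (MeasurableEquiv.prodComm :
      EuclideanSpace ℝ (Fin n) × (Fin (m + 1) → EuclideanSpace ℝ (Fin n)) ≃ᵐ _) :=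
    Measure.measurePreserving_swap
  refine ((h'.comp_equiv hs).comp_equiv (volume_preserving_piFinSuccAbove
    (fun _ : Fin (m + 2) => EuclideanSpace ℝ (Fin n)) 0)).congr (fun w => ?_) (mul_comm _ _)
  exact mul_comm _ _

/-- The density, at `w`, of the heat kernel bridge at the times `s`. -/
noncomputable def bridge (n m : ℕ) (s : Fin (m + 1) → ℝ)
    (w : Fin (m + 1) → EuclideanSpace ℝ (Fin n)) : ℝ :=
  heatG n (1 - s 0) (w 0) * ∏ k, heatG n (s k - fnext s k) (w k - fnext w k)

lemma fnext_zero {m : ℕ} {E : Type*} [Zero E] (s : Fin (m + 2) → E) : fnext s 0 = s 1 := by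
  rw [fnext, dif_pos (by simp)]
  rfl

lemma fnext_succ {m : ℕ} {E : Type*} [Zero E] (s : Fin (m + 2) → E) (k : Fin (m + 1)) :
    fnext s k.succ = fnext (Fin.tail s) k := by
  simp only [fnext, Fin.val_succ, add_lt_add_iff_right]
  rfl

lemma bridge_succ (n : ℕ) {m : ℕ} {s : Fin (m + 2) → ℝ} (h0 : s 0 < 1) (h1 : s 1 < s 0)
    (w : Fin (m + 2) → EuclideanSpace ℝ (Fin n)) :
    bridge n (m + 1) s w =
      heatG n ((1 - s 0) * (s 0 - s 1) / (1 - s 1)) (w 0 - ((1 - s 0) / (1 - s 1)) • w 1) *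
        bridge n m (Fin.tail s) (Fin.tail w) := by
  have h := heatG_mul_heatG_sub n (sub_pos.2 h0) (sub_pos.2 h1) (w 0) (w 1)
  rw [show 1 - s 0 + (s 0 - s 1) = 1 - s 1 by ring] at h
  rw [bridge, Fin.prod_univ_succ, fnext_zero, fnext_zero, ← mul_assoc, h, mul_assoc]
  simp only [fnext_succ]
  rfl

lemma bridge_zero (n : ℕ) {s : Fin 1 → ℝ} (h0 : 0 < s 0) (h1 : s 0 < 1)
    (w : Fin 1 → EuclideanSpace ℝ (Fin n)) :
    bridge n 0 s w = (4 * π) ^ (-(n : ℝ) / 2) * heatG n ((1 - s 0) * s 0) (w 0) := by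
  have h := heatG_mul_heatG_sub n (sub_pos.2 h1) h0 (w 0) 0
  have hz : heatG n 1 0 = (4 * π) ^ (-(n : ℝ) / 2) := by simp [heatG]
  simp only [sub_add_cancel, div_one, smul_zero, sub_zero, hz] at h
  simp [bridge, fnext, h, mul_comm]

lemma tail_mem_simplex {m : ℕ} {s : Fin (m + 1) → ℝ} (hs : s ∈ simplex (m + 1)) :
    Fin.tail s ∈ simplex m :=
  ⟨fun _ _ hij => hs.1 (Fin.succ_lt_succ_iff.2 hij), fun k => hs.2 k.succ⟩

lemma hasVolumeIntegral_bridge (n : ℕ) : ∀ {m : ℕ} {s : Fin (m + 1) → ℝ}, s ∈ simplex (m + 1) →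
    HasVolumeIntegral (bridge n m s) ((4 * π) ^ (-(n : ℝ) / 2))
  | 0, s, hs => by
    have h0 := hs.2 0
    have hc : 0 < (1 - s 0) * s 0 := mul_pos (sub_pos.2 h0.2) h0.1
    exact (((hasVolumeIntegral_heatG n hc).const_mul ((4 * π) ^ (-(n : ℝ) / 2))).comp_equiv
      (volume_preserving_funUnique (Fin 1) (EuclideanSpace ℝ (Fin n)))).congr
      (fun w => bridge_zero n h0.1 h0.2 w) (by simp)
  | m + 1, s, hs => by
    have h0 := (hs.2 0).2
    have h1 : s 1 < s 0 := hs.1 Fin.zero_lt_one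
    have hc : 0 < (1 - s 0) * (s 0 - s 1) / (1 - s 1) :=
      div_pos (mul_pos (sub_pos.2 h0) (sub_pos.2 h1)) (by linarith)
    exact ((hasVolumeIntegral_heatG n hc).layer
      (hasVolumeIntegral_bridge n (tail_mem_simplex hs)) _).congr
      (bridge_succ n h0 h1) (one_mul _).symm

section Moments

variable (n : ℕ) (i : Fin n)

lemma hasVolumeIntegral_coord_mul_bridge_zero {s : Fin 1 → ℝ} (hs : s ∈ simplex 1) :
    HasVolumeIntegral (fun w => w 0 i * bridge n 0 s w) 0 := by
  have h0 := hs.2 0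
  have hc : 0 < (1 - s 0) * s 0 := mul_pos (sub_pos.2 h0.2) h0.1
  refine (((hasVolumeIntegral_coord_mul_heatG n hc i).const_mul
    ((4 * π) ^ (-(n : ℝ) / 2))).comp_equiv
    (volume_preserving_funUnique (Fin 1) (EuclideanSpace ℝ (Fin n)))).congr
    (fun w => ?_) (by simp)
  rw [bridge_zero n h0.1 h0.2]
  exact mul_left_comm _ _ _

lemma hasVolumeIntegral_coord_sq_mul_bridge_zero {s : Fin 1 → ℝ} (hs : s ∈ simplex 1) :
    HasVolumeIntegral (fun w => w 0 i ^ 2 * bridge n 0 s w)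
      ((4 * π) ^ (-(n : ℝ) / 2) * (2 * (s 0 * (1 - s 0)))) := by
  have h0 := hs.2 0
  have hc : 0 < (1 - s 0) * s 0 := mul_pos (sub_pos.2 h0.2) h0.1
  refine (((hasVolumeIntegral_coord_sq_mul_heatG n hc i).const_mul
    ((4 * π) ^ (-(n : ℝ) / 2))).comp_equiv
    (volume_preserving_funUnique (Fin 1) (EuclideanSpace ℝ (Fin n)))).congr
    (fun w => ?_) (by ring)
  rw [bridge_zero n h0.1 h0.2]
  exact mul_left_comm _ _ _

variable {s : Fin 2 → ℝ}

lemma hasVolumeIntegral_coord_one_sq_mul_bridge (hs : s ∈ simplex 2) :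
    HasVolumeIntegral (fun w => w 1 i ^ 2 * bridge n 1 s w)
      ((4 * π) ^ (-(n : ℝ) / 2) * (2 * (s 1 * (1 - s 1)))) := by
  have h0 := (hs.2 0).2
  have h1 : s 1 < s 0 := hs.1 Fin.zero_lt_one
  have hc : 0 < (1 - s 0) * (s 0 - s 1) / (1 - s 1) :=
    div_pos (mul_pos (sub_pos.2 h0) (sub_pos.2 h1)) (by linarith)
  refine ((hasVolumeIntegral_heatG n hc).layer
    (hasVolumeIntegral_coord_sq_mul_bridge_zero n i (tail_mem_simplex hs))
    ((1 - s 0) / (1 - s 1))).congr (fun w => ?_) (one_mul _).symm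
  rw [bridge_succ n h0 h1]
  exact mul_left_comm _ _ _

lemma hasVolumeIntegral_coord_mul_coord_mul_bridge (hs : s ∈ simplex 2) :
    HasVolumeIntegral (fun w => w 0 i * w 1 i * bridge n 1 s w)
      ((4 * π) ^ (-(n : ℝ) / 2) * (2 * (s 1 * (1 - s 0)))) := by
  have h0 := (hs.2 0).2
  have h1 : s 1 < s 0 := hs.1 Fin.zero_lt_one
  have h2 : 0 < 1 - s 1 := by linarith
  have hc : 0 < (1 - s 0) * (s 0 - s 1) / (1 - s 1) :=
    div_pos (mul_pos (sub_pos.2 h0) (sub_pos.2 h1)) h2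
  have ht := tail_mem_simplex hs
  have hA := (hasVolumeIntegral_coord_mul_heatG n hc i).layer
    (hasVolumeIntegral_coord_mul_bridge_zero n i ht) ((1 - s 0) / (1 - s 1))
  have hB := ((hasVolumeIntegral_heatG n hc).layer
    (hasVolumeIntegral_coord_sq_mul_bridge_zero n i ht) ((1 - s 0) / (1 - s 1))).const_mul
    ((1 - s 0) / (1 - s 1))
  refine (hA.add hB).congr (fun w => ?_) ?_
  · rw [bridge_succ n h0 h1]
    simp only [PiLp.sub_apply, PiLp.smul_apply, smul_eq_mul, show Fin.tail w 0 = w 1 from rfl]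
    ring
  · rw [show Fin.tail s 0 = s 1 from rfl]
    field_simp
    ring

lemma hasVolumeIntegral_coord_zero_sq_mul_bridge (hs : s ∈ simplex 2) :
    HasVolumeIntegral (fun w => w 0 i ^ 2 * bridge n 1 s w)
      ((4 * π) ^ (-(n : ℝ) / 2) * (2 * (s 0 * (1 - s 0)))) := by
  have h0 := (hs.2 0).2
  have h1 : s 1 < s 0 := hs.1 Fin.zero_lt_one
  have h2 : 0 < 1 - s 1 := by linarith
  have hc : 0 < (1 - s 0) * (s 0 - s 1) / (1 - s 1) :=
    div_pos (mul_pos (sub_pos.2 h0) (sub_pos.2 h1)) h2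
  have ht := tail_mem_simplex hs
  have hA := (hasVolumeIntegral_coord_sq_mul_heatG n hc i).layer
    (hasVolumeIntegral_bridge n ht) ((1 - s 0) / (1 - s 1))
  have hB := ((hasVolumeIntegral_coord_mul_heatG n hc i).layer
    (hasVolumeIntegral_coord_mul_bridge_zero n i ht) ((1 - s 0) / (1 - s 1))).const_mul
    (2 * ((1 - s 0) / (1 - s 1)))
  have hC := ((hasVolumeIntegral_heatG n hc).layer
    (hasVolumeIntegral_coord_sq_mul_bridge_zero n i ht) ((1 - s 0) / (1 - s 1))).const_mul
    (((1 - s 0) / (1 - s 1)) ^ 2)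
  refine ((hA.add hB).add hC).congr (fun w => ?_) ?_
  · rw [bridge_succ n h0 h1]
    simp only [PiLp.sub_apply, PiLp.smul_apply, smul_eq_mul, show Fin.tail w 0 = w 1 from rfl]
    ring
  · rw [show Fin.tail s 0 = s 1 from rfl]
    field_simp
    ring

end Moments

lemma measurableSet_simplex (m : ℕ) : MeasurableSet (simplex m) := by
  simp only [simplex, StrictAnti, Set.ofPred_and, Set.ofPred_forall]
  refine .inter (.iInter fun i => .iInter fun j => .iInter fun _ => ?_) (.iInter fun k => ?_)
  · exact measurableSet_lt (measurable_pi_apply j) (measurable_pi_apply i)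
  · exact measurable_pi_apply k measurableSet_Ioo

lemma integrableOn_simplex {m : ℕ} {f : (Fin m → ℝ) → ℝ} (hf : Continuous f) :
    IntegrableOn f (simplex m) :=
  (hf.continuousOn.integrableOn_compact (isCompact_Icc (a := 0) (b := 1))).mono_set
    fun _ hs => ⟨fun k => (hs.2 k).1.le, fun k => (hs.2 k).2.le⟩

lemma cons_mem_simplex_iff {m : ℕ} {x : ℝ} {t : Fin (m + 1) → ℝ} :
    (Fin.cons x t : Fin (m + 2) → ℝ) ∈ simplex (m + 2) ↔
      t ∈ simplex (m + 1) ∧ x ∈ Set.Ioo (t 0) 1 := by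
  refine ⟨fun h => ⟨tail_mem_simplex h, h.1 Fin.zero_lt_one, (h.2 0).2⟩, ?_⟩
  rintro ⟨ht, h0, h1⟩
  refine ⟨Fin.strictAnti_iff_succ_lt.2 fun i => ?_, fun k => ?_⟩
  · cases i using Fin.cases with
    | zero => exact h0
    | succ i => exact ht.1 i.castSucc_lt_succ
  · cases k using Fin.cases with
    | zero => exact ⟨(ht.2 0).1.trans h0, h1⟩
    | succ k => exact ht.2 k

/-- Integration over the simplex, with the largest variable integrated out first. -/
lemma setIntegral_simplex_succ {m : ℕ} {f : (Fin (m + 2) → ℝ) → ℝ} (hf : Continuous f) :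
    ∫ s in simplex (m + 2), f s =
      ∫ t in simplex (m + 1), ∫ x in (t 0)..1, f (Fin.cons x t) := by
  have hmp := volume_preserving_piFinSuccAbove (fun _ : Fin (m + 2) => ℝ) 0
  have hint : Integrable ((simplex (m + 2)).indicator f) :=
    (integrable_indicator_iff (measurableSet_simplex _)).2 (integrableOn_simplex hf)
  have hint' := (hmp.symm.integrable_comp_emb
    (MeasurableEquiv.piFinSuccAbove (fun _ : Fin (m + 2) => ℝ) 0).symm.measurableEmbedding).2 hint
  rw [← integral_indicator (measurableSet_simplex _), ← hmp.symm.integral_comp',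
    Measure.volume_eq_prod, integral_prod_symm (fun z => (simplex (m + 2)).indicator f
      ((MeasurableEquiv.piFinSuccAbove (fun _ : Fin (m + 2) => ℝ) 0).symm z)) hint',
    ← integral_indicator (measurableSet_simplex _)]
  congr 1 with t
  have hcons (x : ℝ) : (MeasurableEquiv.piFinSuccAbove (fun _ : Fin (m + 2) => ℝ) 0).symm (x, t) =
      (Fin.cons x t : Fin (m + 2) → ℝ) := by
    simp [MeasurableEquiv.piFinSuccAbove]
    rfl
  simp only [hcons]
  by_cases ht : t ∈ simplex (m + 1)
  · rw [Set.indicator_of_mem ht, intervalIntegral.integral_of_le (ht.2 0).2.le,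
      integral_Ioc_eq_integral_Ioo, ← integral_indicator measurableSet_Ioo]
    congr 1 with x
    classical
    simp [Set.indicator_apply, cons_mem_simplex_iff, ht]
  · simp [ht, cons_mem_simplex_iff]

lemma setIntegral_simplex_one (f : (Fin 1 → ℝ) → ℝ) :
    ∫ s in simplex 1, f s = ∫ y in (0 : ℝ)..1, f fun _ => y := by
  have hmp : MeasurePreserving (MeasurableEquiv.funUnique (Fin 1) ℝ) volume volume :=
    volume_preserving_funUnique (Fin 1) ℝ
  rw [intervalIntegral.integral_of_le zero_le_one, integral_Ioc_eq_integral_Ioo,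
    ← integral_indicator measurableSet_Ioo, ← integral_indicator (measurableSet_simplex _),
    ← hmp.symm.integral_comp']
  congr 1 with y
  have : (MeasurableEquiv.funUnique (Fin 1) ℝ).symm y = fun _ => y := rfl
  simp [this, Set.indicator_apply, simplex, Subsingleton.strictAnti]

lemma setIntegral_simplex_two {f : ℝ → ℝ → ℝ} (hf : Continuous fun p : ℝ × ℝ => f p.1 p.2) :
    ∫ s in simplex 2, f (s 0) (s 1) = ∫ y in (0 : ℝ)..1, ∫ x in y..1, f x y := by
  have hc : Continuous fun s : Fin 2 → ℝ => f (s 0) (s 1) :=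
    hf.comp (f := fun s : Fin 2 → ℝ => (s 0, s 1)) (by fun_prop)
  rw [setIntegral_simplex_succ hc, setIntegral_simplex_one]
  rfl

lemma integral_cubic (a b c₀ c₁ c₂ c₃ : ℝ) :
    ∫ x in a..b, (c₀ + c₁ * x + c₂ * x ^ 2 + c₃ * x ^ 3) =
      c₀ * (b - a) + c₁ * (b ^ 2 - a ^ 2) / 2 + c₂ * (b ^ 3 - a ^ 3) / 3 +
        c₃ * (b ^ 4 - a ^ 4) / 4 := by
  have hi {f : ℝ → ℝ} (hf : Continuous f) : IntervalIntegrable f volume a b :=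
    hf.intervalIntegrable a b
  rw [intervalIntegral.integral_add (hi (by fun_prop)) (hi (by fun_prop)),
    intervalIntegral.integral_add (hi (by fun_prop)) (hi (by fun_prop)),
    intervalIntegral.integral_add (hi (by fun_prop)) (hi (by fun_prop))]
  simp only [intervalIntegral.integral_const_mul (μ := volume), integral_pow, integral_id,
    intervalIntegral.integral_const, smul_eq_mul]
  push_cast
  ring

lemma setIntegral_simplex_zero_mul_one_sub_zero :
    ∫ s in simplex 2, s 0 * (1 - s 0) = 1 / 12 := by
  rw [setIntegral_simplex_two (f := fun x _ => x * (1 - x)) (by fun_prop)]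
  have h (y : ℝ) : ∫ x in y..1, x * (1 - x) =
      1 / 6 + 0 * y + (-1 / 2) * y ^ 2 + (1 / 3) * y ^ 3 := by
    have := integral_cubic y 1 0 1 (-1) 0
    ring_nf at this ⊢
    exact this
  simp only [h, integral_cubic]
  norm_num

lemma setIntegral_simplex_one_mul_one_sub_zero :
    ∫ s in simplex 2, s 1 * (1 - s 0) = 1 / 24 := by
  rw [setIntegral_simplex_two (f := fun x y => y * (1 - x)) (by fun_prop)]
  have h (y : ℝ) : ∫ x in y..1, y * (1 - x) =
      0 + (1 / 2) * y + (-1) * y ^ 2 + (1 / 2) * y ^ 3 := by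
    have := integral_cubic y 1 y (-y) 0 0
    ring_nf at this ⊢
    exact this
  simp only [h, integral_cubic]
  norm_num

lemma setIntegral_simplex_one_mul_one_sub_one :
    ∫ s in simplex 2, s 1 * (1 - s 1) = 1 / 12 := by
  rw [setIntegral_simplex_two (f := fun _ y => y * (1 - y)) (by fun_prop)]
  have h (y : ℝ) : ∫ x in y..1, y * (1 - y) =
      0 + 1 * y + (-2) * y ^ 2 + 1 * y ^ 3 := by
    rw [intervalIntegral.integral_const, smul_eq_mul]
    ring
  simp only [h, integral_cubic]
  norm_num

lemma setIntegral_simplex_three_one : ∫ _ in simplex 3, (1 : ℝ) = 1 / 6 := by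
  rw [setIntegral_simplex_succ (f := fun _ => 1) continuous_const]
  simp only [intervalIntegral.integral_const, smul_eq_mul, mul_one]
  rw [setIntegral_simplex_two (f := fun x _ => 1 - x) (by fun_prop)]
  have h (y : ℝ) : ∫ x in y..1, (1 - x) = 1 / 2 + (-1) * y + (1 / 2) * y ^ 2 + 0 * y ^ 3 := by
    have := integral_cubic y 1 1 (-1) 0 0
    ring_nf at this ⊢
    exact this
  simp only [h, integral_cubic]
  norm_num

lemma measurable_fnext {m : ℕ} {E : Type*} [Zero E] [MeasurableSpace E] (k : Fin m) :
    Measurable fun s : Fin m → E => fnext s k := by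
  unfold fnext
  split_ifs <;> fun_prop

lemma measurable_bridge (n m : ℕ) :
    Measurable fun p : (Fin (m + 1) → EuclideanSpace ℝ (Fin n)) × (Fin (m + 1) → ℝ) =>
      bridge n m p.2 p.1 := by
  unfold bridge
  refine .mul ?_ (Finset.measurable_prod _ fun k _ => ?_)
  · exact (measurable_heatG n).comp (f := fun p : (Fin (m + 1) → EuclideanSpace ℝ (Fin n)) ×
      (Fin (m + 1) → ℝ) => (1 - p.2 0, p.1 0)) (by fun_prop)
  · have h1 : Measurable fun p : (Fin (m + 1) → EuclideanSpace ℝ (Fin n)) × (Fin (m + 1) → ℝ) =>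
        fnext p.2 k := (measurable_fnext k).comp measurable_snd
    have h2 : Measurable fun p : (Fin (m + 1) → EuclideanSpace ℝ (Fin n)) × (Fin (m + 1) → ℝ) =>
        fnext p.1 k := (measurable_fnext k).comp measurable_fst
    exact (measurable_heatG n).comp (f := fun p : (Fin (m + 1) → EuclideanSpace ℝ (Fin n)) ×
      (Fin (m + 1) → ℝ) => (p.2 k - fnext p.2 k, p.1 k - fnext p.1 k)) (by fun_prop)

lemma bridge_nonneg (n : ℕ) {m : ℕ} {s : Fin (m + 1) → ℝ} (hs : s ∈ simplex (m + 1))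
    (w : Fin (m + 1) → EuclideanSpace ℝ (Fin n)) : 0 ≤ bridge n m s w := by
  refine mul_nonneg (heatG_nonneg n (sub_nonneg.2 (hs.2 0).2.le) _)
    (Finset.prod_nonneg fun k _ => heatG_nonneg n (sub_nonneg.2 ?_) _)
  unfold fnext
  split_ifs with h
  · exact (hs.1 (by simp [Fin.lt_def])).le
  · exact (hs.2 k).1.le

lemma integrable_prod_mul_bridge (n : ℕ) {m : ℕ}
    {p : (Fin (m + 1) → EuclideanSpace ℝ (Fin n)) → ℝ} (hp : Measurable p) (hp0 : ∀ w, 0 ≤ p w)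
    {J : (Fin (m + 1) → ℝ) → ℝ} (hJ : Continuous J)
    (h : ∀ s ∈ simplex (m + 1), HasVolumeIntegral (fun w => p w * bridge n m s w) (J s)) :
    Integrable (fun q : (Fin (m + 1) → EuclideanSpace ℝ (Fin n)) × (Fin (m + 1) → ℝ) =>
      p q.1 * bridge n m q.2 q.1) (volume.prod (volume.restrict (simplex (m + 1)))) := by
  have hae : ∀ᵐ s ∂volume.restrict (simplex (m + 1)), s ∈ simplex (m + 1) :=
    ae_restrict_mem (measurableSet_simplex _)
  refine (integrable_prod_iff'
    ((hp.comp measurable_fst).mul (measurable_bridge n m)).aestronglyMeasurable).2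
    ⟨hae.mono fun s hs => (h s hs).1, (integrableOn_simplex hJ).congr ?_⟩
  filter_upwards [hae] with s hs
  rw [← (h s hs).2]
  exact integral_congr_ae (.of_forall fun w =>
    (Real.norm_of_nonneg (mul_nonneg (hp0 w) (bridge_nonneg n hs w))).symm)

lemma integral_setIntegral_mul_bridge (n : ℕ) {m : ℕ}
    {p : (Fin (m + 1) → EuclideanSpace ℝ (Fin n)) → ℝ} {J : (Fin (m + 1) → ℝ) → ℝ}
    (hint : Integrable (fun q : (Fin (m + 1) → EuclideanSpace ℝ (Fin n)) × (Fin (m + 1) → ℝ) =>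
      p q.1 * bridge n m q.2 q.1) (volume.prod (volume.restrict (simplex (m + 1)))))
    (h : ∀ s ∈ simplex (m + 1), HasVolumeIntegral (fun w => p w * bridge n m s w) (J s)) :
    ∫ w, ∫ s in simplex (m + 1), p w * bridge n m s w = ∫ s in simplex (m + 1), J s := by
  rw [integral_integral_swap (f := fun w s => p w * bridge n m s w) hint]
  exact setIntegral_congr_fun (measurableSet_simplex _) fun s hs => (h s hs).2

lemma cCoeff_eq (n j : ℕ) (α : Fin (j + 1) → Fin n → ℕ) :
    cCoeff n j α = (∏ k, ∏ i, (Nat.factorial (α k i) : ℝ))⁻¹ *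
      ∫ w, ∫ s in simplex (j + 1), (∏ k, ∏ i, w k i ^ α k i) * bridge n j s w :=
  rfl

lemma cCoeff_two_zero (n : ℕ) : cCoeff n 2 0 = (4 * π) ^ (-(n : ℝ) / 2) / 6 := by
  have h (s) (hs : s ∈ simplex 3) := (hasVolumeIntegral_bridge n hs).congr
    (g := fun w => 1 * bridge n 2 s w) (fun w => one_mul _) rfl
  have hi := integral_setIntegral_mul_bridge n (p := fun _ => 1) (integrable_prod_mul_bridge n
    measurable_const (fun _ => zero_le_one) continuous_const h) h
  have h3 := setIntegral_simplex_three_one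
  simp only [integral_const, smul_eq_mul, mul_one] at h3
  rw [cCoeff_eq]
  simp only [Pi.zero_apply, pow_zero, Finset.prod_const_one, Nat.factorial_zero, Nat.cast_one,
    inv_one, one_mul] at hi ⊢
  rw [hi, integral_const, h3, smul_eq_mul]
  ring

section

variable (n : ℕ) (i : Fin n)

lemma integrable_coord_sq_zero : Integrable (fun q : (Fin 2 → EuclideanSpace ℝ (Fin n)) ×
    (Fin 2 → ℝ) => q.1 0 i ^ 2 * bridge n 1 q.2 q.1)
    (volume.prod (volume.restrict (simplex 2))) :=
  integrable_prod_mul_bridge n (p := fun w => w 0 i ^ 2) (by fun_prop) (fun _ => sq_nonneg _)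
    (by fun_prop) fun _ hs => hasVolumeIntegral_coord_zero_sq_mul_bridge n i hs

lemma integrable_coord_sq_one : Integrable (fun q : (Fin 2 → EuclideanSpace ℝ (Fin n)) ×
    (Fin 2 → ℝ) => q.1 1 i ^ 2 * bridge n 1 q.2 q.1)
    (volume.prod (volume.restrict (simplex 2))) :=
  integrable_prod_mul_bridge n (p := fun w => w 1 i ^ 2) (by fun_prop) (fun _ => sq_nonneg _)
    (by fun_prop) fun _ hs => hasVolumeIntegral_coord_one_sq_mul_bridge n i hs

lemma integrable_coord_mul_coord : Integrable (fun q : (Fin 2 → EuclideanSpace ℝ (Fin n)) ×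
    (Fin 2 → ℝ) => q.1 0 i * q.1 1 i * bridge n 1 q.2 q.1)
    (volume.prod (volume.restrict (simplex 2))) := by
  refine ((integrable_coord_sq_zero n i).add (integrable_coord_sq_one n i)).mono
    (((by fun_prop : Measurable fun q : (Fin 2 → EuclideanSpace ℝ (Fin n)) × (Fin 2 → ℝ) =>
      q.1 0 i * q.1 1 i).mul (measurable_bridge n 1)).aestronglyMeasurable) (.of_forall fun q => ?_)
  rw [Pi.add_apply, ← add_mul, norm_mul (q.1 0 i * q.1 1 i), norm_mul (_ + _)]
  refine mul_le_mul_of_nonneg_right ?_ (norm_nonneg _)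
  rw [Real.norm_eq_abs, Real.norm_eq_abs, abs_of_nonneg (a := _ + _) (by positivity), abs_le]
  constructor <;> nlinarith [sq_nonneg (q.1 0 i + q.1 1 i), sq_nonneg (q.1 0 i - q.1 1 i)]

lemma prod_coord_pow_single (a b : ℕ) (w : Fin 2 → EuclideanSpace ℝ (Fin n)) :
    ∏ k, ∏ l, w k l ^ (![Pi.single i a, Pi.single i b] : Fin 2 → Fin n → ℕ) k l =
      w 0 i ^ a * w 1 i ^ b := by
  simp [Fin.prod_univ_two, Pi.single_apply, pow_ite, Finset.prod_ite_eq']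

lemma prod_factorial_single (a b : ℕ) :
    ∏ k, ∏ l, (((![Pi.single i a, Pi.single i b] : Fin 2 → Fin n → ℕ) k l).factorial : ℝ) =
      a.factorial * b.factorial := by
  have h (c : ℕ) : ∏ l, (((Pi.single i c : Fin n → ℕ) l).factorial : ℝ) = c.factorial := by
    rw [Finset.prod_eq_single i (fun j _ hj => by simp [hj]) (by simp)]
    simp
  simp [Fin.prod_univ_two, h]

lemma cCoeff_one_single (a b : ℕ) :
    cCoeff n 1 ![Pi.single i a, Pi.single i b] = ((a.factorial : ℝ) * b.factorial)⁻¹ *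
      ∫ w : Fin 2 → EuclideanSpace ℝ (Fin n), ∫ s in simplex 2,
        w 0 i ^ a * w 1 i ^ b * bridge n 1 s w := by
  rw [cCoeff_eq, prod_factorial_single]
  congr 1
  exact integral_congr_ae (.of_forall fun w => integral_congr_ae (.of_forall fun s =>
    congrArg (· * bridge n 1 s w) (prod_coord_pow_single n i a b w)))

lemma cCoeff_single_two_zero :
    cCoeff n 1 ![Pi.single i 2, Pi.single i 0] = (4 * π) ^ (-(n : ℝ) / 2) / 12 := by
  rw [cCoeff_one_single]
  simp only [pow_zero, mul_one]
  have h : ∫ w : Fin 2 → EuclideanSpace ℝ (Fin n), ∫ s in simplex 2, w 0 i ^ 2 * bridge n 1 s w =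
      ∫ s in simplex 2, (4 * π) ^ (-(n : ℝ) / 2) * (2 * (s 0 * (1 - s 0))) :=
    integral_setIntegral_mul_bridge n (integrable_coord_sq_zero n i)
      fun _ hs => hasVolumeIntegral_coord_zero_sq_mul_bridge n i hs
  rw [h, integral_const_mul, integral_const_mul, setIntegral_simplex_zero_mul_one_sub_zero]
  norm_num [Nat.factorial]
  ring

lemma cCoeff_single_zero_two :
    cCoeff n 1 ![Pi.single i 0, Pi.single i 2] = (4 * π) ^ (-(n : ℝ) / 2) / 12 := by
  rw [cCoeff_one_single]
  simp only [pow_zero, one_mul]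
  have h : ∫ w : Fin 2 → EuclideanSpace ℝ (Fin n), ∫ s in simplex 2, w 1 i ^ 2 * bridge n 1 s w =
      ∫ s in simplex 2, (4 * π) ^ (-(n : ℝ) / 2) * (2 * (s 1 * (1 - s 1))) :=
    integral_setIntegral_mul_bridge n (integrable_coord_sq_one n i)
      fun _ hs => hasVolumeIntegral_coord_one_sq_mul_bridge n i hs
  rw [h, integral_const_mul, integral_const_mul, setIntegral_simplex_one_mul_one_sub_one]
  norm_num [Nat.factorial]
  ring

lemma cCoeff_single_one_one :
    cCoeff n 1 ![Pi.single i 1, Pi.single i 1] = (4 * π) ^ (-(n : ℝ) / 2) / 12 := by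
  rw [cCoeff_one_single]
  simp only [pow_one]
  have h : ∫ w : Fin 2 → EuclideanSpace ℝ (Fin n),
      ∫ s in simplex 2, w 0 i * w 1 i * bridge n 1 s w =
      ∫ s in simplex 2, (4 * π) ^ (-(n : ℝ) / 2) * (2 * (s 1 * (1 - s 0))) :=
    integral_setIntegral_mul_bridge n (integrable_coord_mul_coord n i)
      fun _ hs => hasVolumeIntegral_coord_mul_coord_mul_bridge n i hs
  rw [h, integral_const_mul, integral_const_mul, setIntegral_simplex_one_mul_one_sub_zero]
  norm_num [Nat.factorial]
  ring

end

section Reflection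

variable {n : ℕ} (i : Fin n)

/-- The reflection of `ℝⁿ` that changes the sign of the `i`-th coordinate. -/
noncomputable def coordReflection :
    EuclideanSpace ℝ (Fin n) ≃ₗᵢ[ℝ] EuclideanSpace ℝ (Fin n) :=
  LinearIsometryEquiv.piLpCongrRight 2 fun l =>
    if l = i then LinearIsometryEquiv.neg ℝ else LinearIsometryEquiv.refl ℝ ℝ

lemma coordReflection_apply (x : EuclideanSpace ℝ (Fin n)) (l : Fin n) :
    coordReflection i x l = (if l = i then -1 else 1) * x l := by
  simp only [coordReflection, LinearIsometryEquiv.piLpCongrRight_apply]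
  split_ifs <;> simp

lemma heatG_coordReflection (t : ℝ) (x : EuclideanSpace ℝ (Fin n)) :
    heatG n t (coordReflection i x) = heatG n t x := by
  simp [heatG]

lemma bridge_coordReflection {m : ℕ} (s : Fin (m + 1) → ℝ)
    (w : Fin (m + 1) → EuclideanSpace ℝ (Fin n)) :
    bridge n m s (fun k => coordReflection i (w k)) = bridge n m s w := by
  have h (k) : fnext (fun k => coordReflection i (w k)) k = coordReflection i (fnext w k) := by
    unfold fnext
    split_ifs <;> simp
  simp only [bridge, h, ← map_sub, heatG_coordReflection]

lemma cCoeff_eq_zero_of_odd {j : ℕ} {α : Fin (j + 1) → Fin n → ℕ} (hα : Odd (∑ k, α k i)) :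
    cCoeff n j α = 0 := by
  have hmono (w : Fin (j + 1) → EuclideanSpace ℝ (Fin n)) :
      ∏ k, ∏ l, coordReflection i (w k) l ^ α k l = -∏ k, ∏ l, w k l ^ α k l := by
    simp only [coordReflection_apply, mul_pow, Finset.prod_mul_distrib]
    simp [ite_pow, Finset.prod_pow_eq_pow_sum, hα.neg_one_pow]
  have hmp : MeasurePreserving (MeasurableEquiv.piCongrRight fun _ : Fin (j + 1) =>
      (coordReflection i).toMeasurableEquiv) volume volume :=
    volume_preserving_pi fun _ => (coordReflection i).measurePreserving
  have h := hmp.integral_comp' fun w : Fin (j + 1) → EuclideanSpace ℝ (Fin n) =>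
    ∫ s in simplex (j + 1), (∏ k, ∏ l, w k l ^ α k l) * bridge n j s w
  have happ (w : Fin (j + 1) → EuclideanSpace ℝ (Fin n)) :
      (MeasurableEquiv.piCongrRight fun _ : Fin (j + 1) =>
        (coordReflection i).toMeasurableEquiv) w = fun k => coordReflection i (w k) := rfl
  simp only [happ, hmono, bridge_coordReflection, neg_mul, integral_neg] at h
  rw [cCoeff_eq, show ∫ w, _ = (0 : ℝ) by linarith, mul_zero]

end Reflection

/-- `f` is a smooth function with compact support in `Ω`. -/
def IsTestFunction {n : ℕ} (Ω : Set (EuclideanSpace ℝ (Fin n)))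
    (f : EuclideanSpace ℝ (Fin n) → ℝ) : Prop :=
  ContDiff ℝ (⊤ : ℕ∞) f ∧ HasCompactSupport f ∧ tsupport f ⊆ Ω

namespace IsTestFunction

variable {n : ℕ} {Ω : Set (EuclideanSpace ℝ (Fin n))} {f g : EuclideanSpace ℝ (Fin n) → ℝ}

lemma pderiv1 (hf : IsTestFunction Ω f) (i : Fin n) : IsTestFunction Ω (pderiv1 i f) :=
  ⟨(hf.1.fderiv_right (m := (⊤ : ℕ∞)) (by simp)).clm_apply contDiff_const,
    hf.2.1.fderiv_apply ℝ _, (tsupport_fderiv_apply_subset ℝ _).trans hf.2.2⟩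

lemma iterate_pderiv1 (hf : IsTestFunction Ω f) (i : Fin n) (k : ℕ) :
    IsTestFunction Ω ((_root_.pderiv1 i)^[k] f) := by
  induction k with
  | zero => exact hf
  | succ k ih =>
    rw [Function.iterate_succ_apply']
    exact ih.pderiv1 i

lemma integrable_mul (hf : IsTestFunction Ω f) (hg : IsTestFunction Ω g) :
    Integrable fun x => f x * g x :=
  (hf.1.continuous.mul hg.1.continuous).integrable_of_hasCompactSupport hf.2.1.mul_right

lemma setIntegral_mul (hf : IsTestFunction Ω f) (g : EuclideanSpace ℝ (Fin n) → ℝ) :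
    ∫ x in Ω, f x * g x = ∫ x, f x * g x :=
  setIntegral_eq_integral_of_forall_compl_eq_zero fun x hx => by
    rw [image_eq_zero_of_notMem_tsupport fun h => hx (hf.2.2 h), zero_mul]

lemma differentiable (hf : IsTestFunction Ω f) : Differentiable ℝ f :=
  hf.1.differentiable (by simp)

lemma setIntegral_pderiv1 (hf : IsTestFunction Ω f) (i : Fin n) :
    ∫ x in Ω, _root_.pderiv1 i f x = 0 := by
  have h' := hf.pderiv1 i
  have hs := h'.setIntegral_mul fun _ => 1
  simp only [mul_one] at hs
  have hint : Integrable fun x => fderiv ℝ f x (EuclideanSpace.single i 1) :=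
    h'.1.continuous.integrable_of_hasCompactSupport h'.2.1
  have := integral_mul_fderiv_eq_neg_fderiv_mul_of_integrable (μ := volume)
    (f := fun _ : EuclideanSpace ℝ (Fin n) => (1 : ℝ)) (g := f)
    (v := EuclideanSpace.single i 1) (by simp) (by simpa using hint)
    (by simpa using hf.1.continuous.integrable_of_hasCompactSupport hf.2.1)
    (fun _ _ => by fun_prop) (fun x _ => hf.differentiable x)
  rw [hs]
  change ∫ x, fderiv ℝ f x (EuclideanSpace.single i 1) = 0
  simpa using this

lemma setIntegral_mul_pderiv1_pderiv1 (hf : IsTestFunction Ω f) (i : Fin n) :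
    ∫ x in Ω, f x * _root_.pderiv1 i (_root_.pderiv1 i f) x =
      -∫ x in Ω, _root_.pderiv1 i f x ^ 2 := by
  have h' := hf.pderiv1 i
  simp only [sq]
  rw [hf.setIntegral_mul, h'.setIntegral_mul]
  exact integral_mul_fderiv_eq_neg_fderiv_mul_of_integrable
    (h'.integrable_mul h') (hf.integrable_mul (h'.pderiv1 i)) (hf.integrable_mul h')
    (fun x _ => hf.differentiable x) (fun x _ => h'.differentiable x)

end IsTestFunction

section MultiIndex

variable {n : ℕ}

/-- The composition of the operators `∂_l ^ (α l)` for `l` running through the list `L`. -/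
noncomputable def listDeriv (α : Fin n → ℕ) (L : List (Fin n)) :
    (EuclideanSpace ℝ (Fin n) → ℝ) → EuclideanSpace ℝ (Fin n) → ℝ :=
  (L.map fun l => (pderiv1 l)^[α l]).foldr (· ∘ ·) id

lemma mderiv_eq_listDeriv (α : Fin n → ℕ) (f : EuclideanSpace ℝ (Fin n) → ℝ) :
    mderiv α f = listDeriv α (List.finRange n) f := by
  rw [mderiv, List.ofFn_eq_map, listDeriv]

lemma listDeriv_cons (α : Fin n → ℕ) (l : Fin n) (L : List (Fin n))
    (f : EuclideanSpace ℝ (Fin n) → ℝ) :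
    listDeriv α (l :: L) f = (pderiv1 l)^[α l] (listDeriv α L f) :=
  rfl

lemma listDeriv_of_forall_eq_zero {α : Fin n → ℕ} {L : List (Fin n)} (h : ∀ l ∈ L, α l = 0)
    (f : EuclideanSpace ℝ (Fin n) → ℝ) : listDeriv α L f = f := by
  induction L with
  | nil => rfl
  | cons a L ih =>
    rw [List.forall_mem_cons] at h
    rw [listDeriv_cons, h.1, ih h.2, Function.iterate_zero_apply]

lemma listDeriv_single {L : List (Fin n)} (hL : L.Nodup) {i : Fin n} (hi : i ∈ L) (k : ℕ)
    (f : EuclideanSpace ℝ (Fin n) → ℝ) :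
    listDeriv (Pi.single i k) L f = (pderiv1 i)^[k] f := by
  induction L with
  | nil => simp at hi
  | cons a L ih =>
    rw [List.nodup_cons] at hL
    rw [listDeriv_cons]
    rcases eq_or_ne i a with rfl | hia
    · rw [listDeriv_of_forall_eq_zero, Pi.single_eq_same]
      rintro l hl
      exact Pi.single_eq_of_ne (by rintro rfl; exact hL.1 hl) _
    · rw [Pi.single_eq_of_ne hia.symm, Function.iterate_zero_apply,
        ih hL.2 ((List.mem_cons.1 hi).resolve_left hia)]

lemma mderiv_single (i : Fin n) (k : ℕ) (f : EuclideanSpace ℝ (Fin n) → ℝ) :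
    mderiv (Pi.single i k) f = (pderiv1 i)^[k] f := by
  rw [mderiv_eq_listDeriv, listDeriv_single (List.nodup_finRange n) (List.mem_finRange i)]

lemma mderiv_zero (f : EuclideanSpace ℝ (Fin n) → ℝ) : mderiv 0 f = f := by
  rw [mderiv_eq_listDeriv, listDeriv_of_forall_eq_zero (α := 0) fun _ _ => rfl]

variable {Ω : Set (EuclideanSpace ℝ (Fin n))} {V : EuclideanSpace ℝ (Fin n) → ℝ}

lemma IsTestFunction.listDeriv (hV : IsTestFunction Ω V) (α : Fin n → ℕ) (L : List (Fin n)) :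
    IsTestFunction Ω (listDeriv α L V) := by
  induction L with
  | nil => exact hV
  | cons a L ih => exact ih.iterate_pderiv1 a _

lemma exists_listDeriv_eq_pderiv1 (hV : IsTestFunction Ω V) {α : Fin n → ℕ} {L : List (Fin n)}
    (h : ∃ l ∈ L, α l ≠ 0) :
    ∃ i g, IsTestFunction Ω g ∧ listDeriv α L V = pderiv1 i g := by
  induction L with
  | nil => simp at h
  | cons a L ih =>
    rw [listDeriv_cons]
    rcases Nat.eq_zero_or_eq_succ_pred (α a) with ha | ha
    · rw [ha]
      exact ih (by simpa [ha] using h)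
    · refine ⟨a, _, (hV.listDeriv α L).iterate_pderiv1 a (α a).pred, ?_⟩
      rw [ha, Function.iterate_succ_apply']
      rfl

lemma IsTestFunction.setIntegral_mderiv (hV : IsTestFunction Ω V) {α : Fin n → ℕ} (hα : α ≠ 0) :
    ∫ x in Ω, mderiv α V x = 0 := by
  obtain ⟨l, hl⟩ := Function.ne_iff.1 hα
  obtain ⟨i, g, hg, h⟩ := exists_listDeriv_eq_pderiv1 hV ⟨l, List.mem_finRange l, hl⟩
  rw [mderiv_eq_listDeriv, h, hg.setIntegral_pderiv1]

lemma exists_eq_single_of_sum_eq_two {α : Fin 2 → Fin n → ℕ} (hα : ∑ k, ∑ i, α k i = 2)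
    (heven : ∀ i, Even (∑ k, α k i)) :
    ∃ (i : Fin n) (a : Fin 3), α = ![Pi.single i (2 - (a : ℕ)), Pi.single i (a : ℕ)] := by
  rw [Finset.sum_comm] at hα
  obtain ⟨i, -, hi⟩ := Finset.exists_ne_zero_of_sum_ne_zero (hα.trans_ne two_ne_zero)
  have hsum := Finset.add_sum_erase Finset.univ (fun i => ∑ k, α k i) (Finset.mem_univ i)
  have h2 : 2 ≤ ∑ k, α k i := by
    obtain ⟨c, hc⟩ := heven i
    omega
  have hrest : ∑ l ∈ Finset.univ.erase i, ∑ k, α k l = 0 := by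
    omega
  have hz (l) (hl : l ≠ i) (k) : α k l = 0 :=
    Finset.sum_eq_zero_iff.1 (Finset.sum_eq_zero_iff.1 hrest l (by simp [hl])) k (Finset.mem_univ k)
  have hi2 : α 0 i + α 1 i = 2 := by
    simp only [Fin.sum_univ_two] at hsum hrest h2 hα
    omega
  refine ⟨i, ⟨α 1 i, by omega⟩, ?_⟩
  ext k l
  rcases eq_or_ne l i with rfl | hl
  · fin_cases k
    · simp; omega
    · simp
  · fin_cases k <;> simp [hz l hl, hl]

lemma injective_single_pair : Function.Injective fun q : Fin n × Fin 3 =>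
    (![Pi.single q.1 (2 - q.2), Pi.single q.1 q.2] : Fin 2 → Fin n → ℕ) := by
  rintro ⟨i, a⟩ ⟨j, b⟩ h
  have h0 : (2 - a : ℕ) = (Pi.single j (2 - b) : Fin n → ℕ) i := by
    simpa using congrFun (congrFun h 0) i
  have h1 : (a : ℕ) = (Pi.single j (b : ℕ) : Fin n → ℕ) i := by
    simpa using congrFun (congrFun h 1) i
  rcases eq_or_ne i j with rfl | hij
  · simpa [Fin.ext_iff] using h1
  · rw [Pi.single_eq_of_ne hij] at h0 h1
    omega

end MultiIndex

section

variable {n : ℕ} {Ω : Set (EuclideanSpace ℝ (Fin n))} {V : EuclideanSpace ℝ (Fin n) → ℝ}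

lemma tsum_cCoeff_mul_Pcoef_zero (hV : IsTestFunction Ω V) :
    ∑' α : Fin 1 → Fin n → ℕ, (if ∑ k, ∑ i, α k i = 4 then
      cCoeff n 0 α * Pcoef n 0 Ω α V else 0) = 0 := by
  refine (tsum_congr fun α => ?_).trans tsum_zero
  split_ifs with h
  · have hα : α 0 ≠ 0 := by
      intro h0
      simp [h0] at h
    simp [Pcoef, hV.setIntegral_mderiv hα]
  · rfl

lemma Pcoef_single_single (i : Fin n) (a b : ℕ) :
    Pcoef n 1 Ω ![Pi.single i a, Pi.single i b] V =
      ∫ x in Ω, (pderiv1 i)^[a] V x * (pderiv1 i)^[b] V x := by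
  rw [← mderiv_single, ← mderiv_single]
  exact integral_congr_ae (.of_forall fun x => Fin.prod_univ_two _)

lemma tsum_cCoeff_mul_Pcoef_one (hV : IsTestFunction Ω V) :
    ∑' α : Fin 2 → Fin n → ℕ, (if ∑ k, ∑ i, α k i = 2 then
      cCoeff n 1 α * Pcoef n 1 Ω α V else 0) =
      -((4 * π) ^ (-(n : ℝ) / 2) / 12) * ∫ x in Ω, ∑ i, pderiv1 i V x ^ 2 := by
  rw [tsum_eq_sum (s := Finset.univ.image fun q : Fin n × Fin 3 =>
      (![Pi.single q.1 (2 - q.2), Pi.single q.1 q.2] : Fin 2 → Fin n → ℕ)),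
    Finset.sum_image injective_single_pair.injOn, Fintype.sum_prod_type, integral_finsetSum,
    Finset.mul_sum]
  · refine Finset.sum_congr rfl fun i _ => ?_
    have h2 := hV.setIntegral_mul_pderiv1_pderiv1 i
    have hsum (a b : ℕ) :
        ∑ k : Fin 2, ∑ l, (![Pi.single i a, Pi.single i b] : Fin 2 → Fin n → ℕ) k l = a + b := by
      simp [Fin.sum_univ_two]
    simp only [Fin.sum_univ_three, hsum, Pcoef_single_single]
    have h2' := h2
    simp only [mul_comm (V _)] at h2'
    simp only [Fin.val_zero, Fin.val_one, Fin.val_two, Nat.sub_zero, Nat.sub_self, Nat.reduceSub,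
      Nat.reduceAdd, if_true, cCoeff_single_two_zero, cCoeff_single_zero_two,
      cCoeff_single_one_one, Function.iterate_succ, Function.iterate_zero, Function.comp_apply,
      id_eq, h2, h2', ← sq]
    ring
  · intro i _
    simp only [sq]
    exact ((hV.pderiv1 i).integrable_mul (hV.pderiv1 i)).integrableOn
  · intro α hα
    split_ifs with h
    · rw [mul_eq_zero]
      left
      by_contra hc
      obtain ⟨i, a, h'⟩ := exists_eq_single_of_sum_eq_two h fun i =>
        Nat.not_odd_iff_even.1 fun ho => hc (cCoeff_eq_zero_of_odd i ho)
      exact hα (Finset.mem_image.2 ⟨(i, a), Finset.mem_univ _, h'.symm⟩)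
    · rfl

lemma tsum_cCoeff_mul_Pcoef_two :
    ∑' α : Fin 3 → Fin n → ℕ, (if ∑ k, ∑ i, α k i = 0 then
      cCoeff n 2 α * Pcoef n 2 Ω α V else 0) =
      (4 * π) ^ (-(n : ℝ) / 2) / 6 * ∫ x in Ω, V x ^ 3 := by
  rw [tsum_eq_single 0]
  · simp [cCoeff_two_zero, Pcoef, mderiv_zero]
  · intro α hα
    rw [if_neg]
    intro h
    simp only [Finset.sum_eq_zero_iff, Finset.mem_univ, forall_const] at h
    exact hα (funext₂ h)

end

theorem Pscr_six (n : ℕ) (Ω : Set (EuclideanSpace ℝ (Fin n)))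
    (hΩ : IsOpen Ω) (hbdd : Bornology.IsBounded Ω)
    (V : EuclideanSpace ℝ (Fin n) → ℝ) (hV : ContDiff ℝ (⊤ : ℕ∞) V)
    (hcpt : HasCompactSupport V) (hsupp : tsupport V ⊆ Ω) :
    Pscr n Ω 3 V =
      -((4 * Real.pi) ^ (-(n : ℝ) / 2) / 6) *
        ((1 / 2) * (∫ x in Ω, ∑ i, pderiv1 i V x ^ 2) + ∫ x in Ω, V x ^ 3) := by
  have hV' : IsTestFunction Ω V := ⟨hV, hcpt, hsupp⟩
  have h0 := tsum_cCoeff_mul_Pcoef_zero hV'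
  have h1 := tsum_cCoeff_mul_Pcoef_one hV'
  have h2 := tsum_cCoeff_mul_Pcoef_two (Ω := Ω) (V := V)
  simp only [Pscr, Finset.sum_range_succ, Finset.sum_range_zero]
  norm_num only
  rw [h0, h1, h2]
  ring
end
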